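/- arXiv:2407.01966 — 8 statements merged into one kernel-verified Lean document; each statement's English description precedes it below -/
import Mathlib

section
/- Let T be a finite tree on n vertices, let D be its distance matrix, and let S be a subset of the vertices of cardinality m ≥ 2. Then the principal minor of D indexed by S satisfies det D[S] = (-1)^{m-1} · 2^{m-2} · ( (m-1)·|F_S(T)| − Σ_{F ∈ F_{S,*}(T)} (bdeg(F_*) − 1)·(bdeg(F_*) − 4) ), where the sum is over all (S,*)-rooted spanning forests F of T and F_* denotes the floating component of F. -/
open scoped Classical

/-- `H` is an `S`-rooted spanning forest of `G`: an acyclic spanning subgraph in which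
distinct vertices of `S` lie in distinct connected components and every vertex is
reachable from some vertex of `S` (so there are exactly `|S|` components, each
containing exactly one vertex of `S`). -/
def IsSRootedForest {V : Type*} (G H : SimpleGraph V) (S : Finset V) : Prop :=
  H ≤ G ∧ H.IsAcyclic ∧
    (∀ s ∈ S, ∀ t ∈ S, H.Reachable s t → s = t) ∧
    (∀ v : V, ∃ s ∈ S, H.Reachable s v)

/-- The set of vertices not reachable from `S` in `H`; for an `(S,*)`-rooted forest
this is the vertex set of the floating component. -/
def floatSet {V : Type*} (H : SimpleGraph V) (S : Finset V) : Set V :=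
  {v | ∀ s ∈ S, ¬ H.Reachable s v}

/-- `H` is an `(S,*)`-rooted spanning forest of `G`: an acyclic spanning subgraph with
distinct vertices of `S` in distinct components, and whose vertices not reachable from
`S` form a single nonempty connected component (the floating component). -/
def IsSStarRootedForest {V : Type*} (G H : SimpleGraph V) (S : Finset V) : Prop :=
  H ≤ G ∧ H.IsAcyclic ∧
    (∀ s ∈ S, ∀ t ∈ S, H.Reachable s t → s = t) ∧
    (floatSet H S).Nonempty ∧
    (∀ v ∈ floatSet H S, ∀ w ∈ floatSet H S, H.Reachable v w)

/-- The boundary degree of the floating component of `H`: the number of vertices not in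
the floating component that are adjacent in `G` to some vertex of the floating
component. -/
noncomputable def bdeg {V : Type*} (G H : SimpleGraph V) (S : Finset V) : ℕ :=
  Set.ncard {v | v ∉ floatSet H S ∧ ∃ w ∈ floatSet H S, G.Adj v w}

namespace SimpleGraph

variable {V : Type*} {G : SimpleGraph V}

/-- In a tree, every vertex `a ≠ v` has a unique neighbour closer to `v`. -/
theorem IsTree.existsUnique_adj_dist_lt (hG : G.IsTree) {v a : V} (h : a ≠ v) :
    ∃! b, G.Adj a b ∧ G.dist v b < G.dist v a := by
  obtain ⟨p, hp⟩ := hG.connected.exists_walk_length_eq_dist a v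
  cases p with
  | nil => exact absurd rfl h
  | @cons _ b _ hab p =>
    rw [Walk.length_cons] at hp
    refine ⟨b, ⟨hab, ?_⟩, ?_⟩
    · have := dist_le p
      rw [dist_comm, @dist_comm _ _ v a]
      omega
    · rintro c ⟨hac, hc⟩
      obtain ⟨q, hq⟩ := hG.connected.exists_walk_length_eq_dist c v
      have h1 : (Walk.cons hac q).length = G.dist a v := by
        rw [Walk.length_cons, hq]
        have := hG.dist_eq_dist_add_one_of_adj v hac
        rw [@dist_comm _ _ c v, @dist_comm _ _ a v]
        omega
      have h2 := Walk.isPath_of_length_eq_dist _ h1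
      have h3 := Walk.isPath_of_length_eq_dist (Walk.cons hab p) (by simpa using hp)
      have h4 := (hG.existsUnique_path a v).unique h2 h3
      simpa using congrArg Walk.snd h4

/-- In a tree, the two sides of an edge `xy` are joined by no other edge. -/
theorem IsTree.eq_of_adj_of_separated (hG : G.IsTree) {x y a b : V} (hxy : G.Adj x y)
    (hab : G.Adj a b) (ha : G.dist a x < G.dist a y) (hb : G.dist b y < G.dist b x) :
    a = x ∧ b = y := by
  have e1 := hG.dist_eq_dist_add_one_of_adj a hxy
  have e2 := hG.dist_eq_dist_add_one_of_adj b hxy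
  have e3 := hG.dist_eq_dist_add_one_of_adj x hab
  have e4 := hG.dist_eq_dist_add_one_of_adj y hab
  simp only [@dist_comm _ G x, @dist_comm _ G y] at e3 e4
  have hax : a = x := by
    by_contra hne
    obtain ⟨c, ⟨hac, hc⟩, -⟩ := hG.existsUnique_adj_dist_lt hne
    have hay : a ≠ y := by
      rintro rfl
      simp at ha
    obtain ⟨d, -, hd⟩ := hG.existsUnique_adj_dist_lt hay
    have e5 := hG.dist_eq_dist_add_one_of_adj x hac
    have e6 := hG.dist_eq_dist_add_one_of_adj y hac
    have e7 := hG.dist_eq_dist_add_one_of_adj c hxy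
    simp only [@dist_comm _ G x, @dist_comm _ G y] at e5 e6 hc hd
    have h1 := hd c ⟨hac, by omega⟩
    have h2 := hd b ⟨hab, by omega⟩
    subst h1
    subst h2
    omega
  subst hax
  refine ⟨rfl, ?_⟩
  rw [← hG.connected.dist_eq_zero_iff]
  rw [dist_self] at *
  omega

/-- If a subgraph of a tree connects the two sides of an edge, then it contains this edge. -/
theorem IsTree.adj_of_reachable_of_separated (hG : G.IsTree) {H : SimpleGraph V} (hH : H ≤ G)
    {x y u v : V} (hxy : G.Adj x y) (huv : H.Reachable u v)
    (hu : G.dist u x < G.dist u y) (hv : G.dist v y < G.dist v x) : H.Adj x y := by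
  obtain ⟨p⟩ := huv
  induction p with
  | nil => omega
  | @cons a b c hab p ih =>
    rcases hG.dist_eq_dist_add_one_of_adj b hxy with h | h
    · obtain ⟨rfl, rfl⟩ := hG.eq_of_adj_of_separated hxy (hH hab) hu (by omega)
      exact hab
    · exact ih (by omega) hv

/-- Reachability after adding a single edge. -/
theorem Reachable.of_adj_or_edge {F H : SimpleGraph V} {i w : V}
    (h : ∀ a b, H.Adj a b → F.Adj a b ∨ (a = i ∧ b = w) ∨ (a = w ∧ b = i)) {u v : V}
    (huv : H.Reachable u v) :
    F.Reachable u v ∨ (F.Reachable u i ∧ F.Reachable w v) ∨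
      (F.Reachable u w ∧ F.Reachable i v) := by
  obtain ⟨p⟩ := huv
  induction p with
  | nil => exact Or.inl (Reachable.refl _)
  | @cons a b c hab p ih =>
    rcases h a b hab with hab | ⟨rfl, rfl⟩ | ⟨rfl, rfl⟩
    · have := hab.reachable
      rcases ih with ih | ⟨ih, ih'⟩ | ⟨ih, ih'⟩
      · exact Or.inl (this.trans ih)
      · exact Or.inr (Or.inl ⟨this.trans ih, ih'⟩)
      · exact Or.inr (Or.inr ⟨this.trans ih, ih'⟩)
    · rcases ih with ih | ⟨ih, ih'⟩ | ⟨ih, ih'⟩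
      · exact Or.inr (Or.inl ⟨Reachable.refl _, ih⟩)
      · exact Or.inr (Or.inl ⟨Reachable.refl _, ih'⟩)
      · exact Or.inl ih'
    · rcases ih with ih | ⟨ih, ih'⟩ | ⟨ih, ih'⟩
      · exact Or.inr (Or.inr ⟨Reachable.refl _, ih⟩)
      · exact Or.inl ih'
      · exact Or.inr (Or.inr ⟨Reachable.refl _, ih'⟩)

end SimpleGraph

section Forests

open SimpleGraph

variable {V : Type*} {G : SimpleGraph V} {S : Finset V}

theorem mem_floatSet_of_reachable {H : SimpleGraph V} {v w : V} (hv : v ∈ floatSet H S)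
    (h : H.Reachable v w) : w ∈ floatSet H S :=
  fun s hs hsw => hv s hs (hsw.trans h.symm)

theorem notMem_floatSet_of_mem {H : SimpleGraph V} {v : V} (hv : v ∈ S) : v ∉ floatSet H S :=
  fun h => h v hv (Reachable.refl _)

theorem SimpleGraph.Reachable.deleteEdges_cases {H : SimpleGraph V} (i w : V) {u v : V}
    (h : H.Reachable u v) :
    (H.deleteEdges {s(i, w)}).Reachable u v ∨
      ((H.deleteEdges {s(i, w)}).Reachable u i ∧ (H.deleteEdges {s(i, w)}).Reachable w v) ∨
      ((H.deleteEdges {s(i, w)}).Reachable u w ∧ (H.deleteEdges {s(i, w)}).Reachable i v) := by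
  refine h.of_adj_or_edge fun a b hab => ?_
  rw [deleteEdges_adj, Set.mem_singleton_iff, Sym2.eq_iff]
  tauto

/-- Deleting an edge of a rooted forest that separates `i` from its root. -/
theorem IsSRootedForest.deleteEdges {H : SimpleGraph V} (hH : IsSRootedForest G H S) {i w : V}
    (hi : i ∈ floatSet (H.deleteEdges {s(i, w)}) S) :
    IsSStarRootedForest G (H.deleteEdges {s(i, w)}) S ∧
      w ∉ floatSet (H.deleteEdges {s(i, w)}) S := by
  obtain ⟨hle, hac, hinj, hcov⟩ := hH
  have hle' : H.deleteEdges {s(i, w)} ≤ H := deleteEdges_le _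
  have key : ∀ v ∈ floatSet (H.deleteEdges {s(i, w)}) S,
      ∃ s ∈ S, (H.deleteEdges {s(i, w)}).Reachable s w ∧
        (H.deleteEdges {s(i, w)}).Reachable i v := by
    intro v hv
    obtain ⟨s, hs, hsv⟩ := hcov v
    rcases hsv.deleteEdges_cases i w with h | ⟨h, -⟩ | h
    · exact absurd h (hv s hs)
    · exact absurd h (hi s hs)
    · exact ⟨s, hs, h⟩
  refine ⟨⟨hle'.trans hle, hac.anti hle', fun s hs t ht h => hinj s hs t ht (h.mono hle'),
    ⟨i, hi⟩, fun v hv v' hv' => ?_⟩, fun hw => ?_⟩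
  · obtain ⟨-, -, -, h1⟩ := key v hv
    obtain ⟨-, -, -, h2⟩ := key v' hv'
    exact h1.symm.trans h2
  · obtain ⟨s, hs, h, -⟩ := key i hi
    exact hw s hs h

/-- Joining the floating component to another component by an edge. -/
theorem IsSStarRootedForest.sup_edge (hG : G.IsAcyclic) {F : SimpleGraph V}
    (hF : IsSStarRootedForest G F S) {i w : V} (hiw : G.Adj i w)
    (hi : i ∈ floatSet F S) (hw : w ∉ floatSet F S) :
    IsSRootedForest G (F ⊔ edge i w) S ∧ (F ⊔ edge i w).Adj i w ∧
      (F ⊔ edge i w).deleteEdges {s(i, w)} = F := by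
  obtain ⟨hle, hac, hinj, hne, hfl⟩ := hF
  have hle' : F ⊔ edge i w ≤ G := sup_le hle (by
    intro a b hab
    rw [edge_adj] at hab
    rcases hab.1 with ⟨rfl, rfl⟩ | ⟨rfl, rfl⟩
    · exact hiw
    · exact hiw.symm)
  have hadj : (F ⊔ edge i w).Adj i w := by
    rw [sup_adj, edge_adj]
    exact Or.inr ⟨Or.inl ⟨rfl, rfl⟩, hiw.ne⟩
  have hnadj : ¬ F.Adj i w := fun h => hw (mem_floatSet_of_reachable hi h.reachable)
  have hcases : ∀ a b, (F ⊔ edge i w).Adj a b → F.Adj a b ∨ (a = i ∧ b = w) ∨ (a = w ∧ b = i) := by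
    intro a b hab
    rw [sup_adj, edge_adj] at hab
    tauto
  refine ⟨⟨hle', hG.anti hle', fun s hs t ht h => ?_, fun v => ?_⟩, hadj, ?_⟩
  · rcases h.of_adj_or_edge hcases with h | ⟨h, -⟩ | ⟨-, h⟩
    · exact hinj s hs t ht h
    · exact absurd h (hi s hs)
    · exact absurd h.symm (hi t ht)
  · by_cases hv : v ∈ floatSet F S
    · simp only [floatSet, Set.mem_ofPred_eq, not_forall, not_not] at hw
      obtain ⟨s, hs, hsw⟩ := hw
      exact ⟨s, hs, ((hsw.mono le_sup_left).trans hadj.symm.reachable).trans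
        ((hfl i hi v hv).mono le_sup_left)⟩
    · simp only [floatSet, Set.mem_ofPred_eq, not_forall, not_not] at hv
      obtain ⟨s, hs, hsv⟩ := hv
      exact ⟨s, hs, hsv.mono le_sup_left⟩
  · ext a b
    rw [deleteEdges_adj, Set.mem_singleton_iff, Sym2.eq_iff]
    constructor
    · rintro ⟨h1, h2⟩
      rcases hcases a b h1 with h | h | h
      · exact h
      · tauto
      · tauto
    · refine fun h => ⟨Or.inl h, ?_⟩
      rintro (⟨rfl, rfl⟩ | ⟨rfl, rfl⟩)
      · exact hnadj h
      · exact hnadj h.symm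

/-- In a rooted forest, the edge from `i` to `w` is crossed in this direction, from below, by the
path from `j` to its root `s` if and only if `w` is closer to `s` and `i` is closer to `j`. -/
theorem IsSRootedForest.adj_and_mem_floatSet_iff (hG : G.IsTree) {H : SimpleGraph V}
    (hH : IsSRootedForest G H S) {s j : V} (hs : s ∈ S) (hsj : H.Reachable s j) {i w : V}
    (hiw : G.Adj i w) :
    (H.Adj i w ∧ i ∈ floatSet (H.deleteEdges {s(i, w)}) S ∧
      j ∈ floatSet (H.deleteEdges {s(i, w)}) S) ↔
    (G.dist s w < G.dist s i ∧ ¬ G.dist j w < G.dist j i) := by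
  obtain ⟨hle, hac, hinj, hcov⟩ := hH
  have hle' : H.deleteEdges {s(i, w)} ≤ H := deleteEdges_le _
  have hnadj : ¬ (H.deleteEdges {s(i, w)}).Adj i w := by simp
  have cross : ∀ u v, (H.deleteEdges {s(i, w)}).Reachable u v → G.dist u w < G.dist u i →
      G.dist v i < G.dist v w → False := fun u v huv h1 h2 =>
    hnadj (hG.adj_of_reachable_of_separated (hle'.trans hle) hiw.symm huv h1 h2).symm
  have hii : G.dist i i < G.dist i w := by
    rw [dist_self, dist_eq_one_iff_adj.mpr hiw]
    exact one_pos
  have hww : G.dist w w < G.dist w i := by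
    rw [dist_self, dist_eq_one_iff_adj.mpr hiw.symm]
    exact one_pos
  have es := hG.dist_eq_dist_add_one_of_adj s hiw
  have ej := hG.dist_eq_dist_add_one_of_adj j hiw
  constructor
  · rintro ⟨-, hi, hj⟩
    rcases hsj.deleteEdges_cases i w with h | ⟨h, -⟩ | ⟨h1, h2⟩
    · exact absurd h (hj s hs)
    · exact absurd h (hi s hs)
    · refine ⟨?_, fun h => cross j i h2.symm h hii⟩
      by_contra hcon
      exact cross w s h1.symm hww (by omega)
  · rintro ⟨h1, h2⟩
    have h2' : G.dist j i < G.dist j w := by omega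
    have hij : (H.deleteEdges {s(i, w)}).Reachable i j := by
      rcases hsj.deleteEdges_cases i w with h | ⟨h, -⟩ | ⟨-, h⟩
      · exact (cross s j h h1 h2').elim
      · exact (cross s i h h1 hii).elim
      · exact h
    have hi : i ∈ floatSet (H.deleteEdges {s(i, w)}) S := by
      intro t ht hti
      have hts : t = s := hinj t ht s hs (((hti.trans hij).mono hle').trans hsj.symm)
      subst hts
      exact cross t i hti h1 hii
    exact ⟨(hG.adj_of_reachable_of_separated hle hiw.symm hsj h1 h2').symm, hi,
      mem_floatSet_of_reachable hi hij⟩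

theorem IsSStarRootedForest.iff_insert {F : SimpleGraph V} {i : V} (hi : i ∉ S) :
    IsSStarRootedForest G F S ∧ i ∈ floatSet F S ↔ IsSRootedForest G F (insert i S) := by
  constructor
  · rintro ⟨⟨hle, hac, hinj, -, hfl⟩, hif⟩
    refine ⟨hle, hac, fun s hs t ht h => ?_, fun v => ?_⟩
    · rw [Finset.mem_insert] at hs ht
      rcases hs with rfl | hs <;> rcases ht with rfl | ht
      · rfl
      · exact absurd h.symm (hif t ht)
      · exact absurd h (hif s hs)
      · exact hinj s hs t ht h
    · by_cases hv : v ∈ floatSet F S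
      · exact ⟨i, Finset.mem_insert_self i S, hfl i hif v hv⟩
      · simp only [floatSet, Set.mem_ofPred_eq, not_forall, not_not] at hv
        obtain ⟨s, hs, h⟩ := hv
        exact ⟨s, Finset.mem_insert_of_mem hs, h⟩
  · rintro ⟨hle, hac, hinj, hcov⟩
    have key : ∀ v ∈ floatSet F S, F.Reachable i v := by
      intro v hv
      obtain ⟨s, hs, h⟩ := hcov v
      rcases Finset.mem_insert.mp hs with rfl | hs
      · exact h
      · exact absurd h (hv s hs)
    have hif : i ∈ floatSet F S := by
      intro s hs h
      have := hinj s (Finset.mem_insert_of_mem hs) i (Finset.mem_insert_self i S) h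
      exact hi (this ▸ hs)
    exact ⟨⟨hle, hac, fun s hs t ht =>
      hinj s (Finset.mem_insert_of_mem hs) t (Finset.mem_insert_of_mem ht), ⟨i, hif⟩,
      fun v hv w hw => (key v hv).symm.trans (key w hw)⟩, hif⟩

theorem isSRootedForest_singleton_iff (hG : G.IsTree) (v : V) (H : SimpleGraph V) :
    IsSRootedForest G H {v} ↔ H = G := by
  constructor
  · rintro ⟨hle, -, -, hcov⟩
    refine le_antisymm hle fun x y hxy => ?_
    have key : ∀ u, H.Reachable v u := fun u => by
      obtain ⟨s, hs, h⟩ := hcov u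
      rwa [Finset.mem_singleton.mp hs] at h
    refine hG.adj_of_reachable_of_separated hle hxy ((key x).symm.trans (key y)) ?_ ?_
    · rw [dist_self, dist_eq_one_iff_adj.mpr hxy]
      exact one_pos
    · rw [dist_self, dist_eq_one_iff_adj.mpr hxy.symm]
      exact one_pos
  · rintro rfl
    refine ⟨le_rfl, hG.isAcyclic, fun s hs t ht _ => ?_, fun u =>
      ⟨v, Finset.mem_singleton_self v, hG.connected v u⟩⟩
    rw [Finset.mem_singleton.mp hs, Finset.mem_singleton.mp ht]

theorem exists_isSRootedForest (hG : G.IsTree) (hS : S.Nonempty) :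
    ∃ H, IsSRootedForest G H S := by
  induction hS using Finset.Nonempty.cons_induction with
  | singleton v => exact ⟨G, (isSRootedForest_singleton_iff hG v G).mpr rfl⟩
  | cons i S hi hS ih =>
    obtain ⟨H, hH⟩ := ih
    rw [Finset.cons_eq_insert]
    obtain ⟨s, hs, hsi⟩ := hH.2.2.2 i
    have his : i ≠ s := fun h => hi (h ▸ hs)
    obtain ⟨w, ⟨hiw, hlt⟩, -⟩ := hG.existsUnique_adj_dist_lt his
    have h := ((hH.adj_and_mem_floatSet_iff hG hs hsi hiw).mpr ⟨hlt, by simp⟩).2.1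
    exact ⟨_, (IsSStarRootedForest.iff_insert hi).mp ⟨(hH.deleteEdges h).1, h⟩⟩

variable [Fintype V]

theorem SimpleGraph.IsTree.sum_adj_dist_lt (hG : G.IsTree) (v i : V) :
    (∑ w, if G.Adj i w ∧ G.dist v w < G.dist v i then (1 : ℤ) else 0) =
      if i = v then 0 else 1 := by
  rw [Finset.sum_boole]
  split_ifs with h
  · subst h
    simp
  · obtain ⟨b, hb, hb'⟩ := hG.existsUnique_adj_dist_lt h
    rw [Nat.cast_eq_one, Finset.card_eq_one]
    refine ⟨b, ?_⟩
    ext w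
    simp only [Finset.mem_filter, Finset.mem_univ, true_and, Finset.mem_singleton]
    exact ⟨hb' w, fun h => h ▸ hb⟩

theorem sum_starForest_eq_sum_rootedForest (hG : G.IsAcyclic) {i w : V} (hiw : G.Adj i w) (j : V) :
    (∑ F : SimpleGraph V with IsSStarRootedForest G F S,
      if i ∈ floatSet F S ∧ j ∈ floatSet F S ∧ w ∉ floatSet F S then (1 : ℤ) else 0) =
    ∑ H : SimpleGraph V with IsSRootedForest G H S,
      if H.Adj i w ∧ i ∈ floatSet (H.deleteEdges {s(i, w)}) S ∧
        j ∈ floatSet (H.deleteEdges {s(i, w)}) S then 1 else 0 := by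
  rw [Finset.sum_boole, Finset.sum_boole, Nat.cast_inj]
  refine Finset.card_bij' (fun F _ => F ⊔ edge i w) (fun H _ => H.deleteEdges {s(i, w)})
    ?_ ?_ ?_ ?_
  · intro F hF
    simp only [Finset.mem_filter, Finset.mem_univ, true_and] at hF ⊢
    obtain ⟨hF, hi, hj, hw⟩ := hF
    obtain ⟨h1, h2, h3⟩ := hF.sup_edge hG hiw hi hw
    rw [h3]
    exact ⟨h1, h2, hi, hj⟩
  · intro H hH
    simp only [Finset.mem_filter, Finset.mem_univ, true_and] at hH ⊢
    obtain ⟨hH, -, hi, hj⟩ := hH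
    obtain ⟨h1, h2⟩ := hH.deleteEdges hi
    exact ⟨h1, hi, hj, h2⟩
  · intro F hF
    simp only [Finset.mem_filter, Finset.mem_univ, true_and] at hF
    obtain ⟨hF, hi, hj, hw⟩ := hF
    exact (hF.sup_edge hG hiw hi hw).2.2
  · intro H hH
    simp only [Finset.mem_filter, Finset.mem_univ, true_and] at hH
    obtain ⟨hH, hadj, hi, hj⟩ := hH
    ext a b
    rw [sup_adj, deleteEdges_adj, Set.mem_singleton_iff, Sym2.eq_iff, edge_adj]
    constructor
    · rintro (h | ⟨⟨rfl, rfl⟩ | ⟨rfl, rfl⟩, -⟩)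
      · exact h.1
      · exact hadj
      · exact hadj.symm
    · intro h
      have := h.ne
      tauto

/-- The number of `S`-rooted spanning forests of `G`. -/
noncomputable def rootedCount (G : SimpleGraph V) (S : Finset V) : ℤ :=
  (Finset.univ.filter (fun H : SimpleGraph V => IsSRootedForest G H S)).card

/-- The matrix counting the `(S,*)`-rooted spanning forests of `G` whose floating component
contains two given vertices. -/
noncomputable def floatMatrix (G : SimpleGraph V) (S : Finset V) : Matrix V V ℤ :=
  Matrix.of fun i j => ∑ F : SimpleGraph V with IsSStarRootedForest G F S,
    if i ∈ floatSet F S ∧ j ∈ floatSet F S then 1 else 0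

theorem sum_adj_rootedForest (hG : G.IsTree) {H : SimpleGraph V} (hH : IsSRootedForest G H S)
    {i : V} (hi : i ∉ S) (j : V) :
    (∑ w, if G.Adj i w then
      (if H.Adj i w ∧ i ∈ floatSet (H.deleteEdges {s(i, w)}) S ∧
        j ∈ floatSet (H.deleteEdges {s(i, w)}) S then (1 : ℤ) else 0) -
      (if H.Adj w i ∧ w ∈ floatSet (H.deleteEdges {s(w, i)}) S ∧
        j ∈ floatSet (H.deleteEdges {s(w, i)}) S then 1 else 0) else 0) =
      if i = j then 1 else 0 := by
  obtain ⟨s, hs, hsj⟩ := hH.2.2.2 j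
  have his : i ≠ s := fun h => hi (h ▸ hs)
  have h1 := hG.sum_adj_dist_lt s i
  have h2 := hG.sum_adj_dist_lt j i
  rw [if_neg his] at h1
  trans (1 : ℤ) - if i = j then 0 else 1
  · rw [← h2, ← h1, ← Finset.sum_sub_distrib]
    refine Finset.sum_congr rfl fun w _ => ?_
    by_cases hiw : G.Adj i w
    · rw [if_pos hiw, if_congr (hH.adj_and_mem_floatSet_iff hG hs hsj hiw) rfl rfl,
        if_congr (hH.adj_and_mem_floatSet_iff hG hs hsj hiw.symm) rfl rfl]
      have es := hG.dist_eq_dist_add_one_of_adj s hiw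
      have ej := hG.dist_eq_dist_add_one_of_adj j hiw
      simp only [hiw, true_and]
      split_ifs <;> omega
    · simp [hiw]
  · split_ifs <;> rfl

theorem sum_adj_floatMatrix (hG : G.IsTree) {i : V} (hi : i ∉ S) (j : V) :
    (∑ w, if G.Adj i w then floatMatrix G S i j - floatMatrix G S w j else 0) =
      if i = j then rootedCount G S else 0 := by
  have step : ∀ w, (if G.Adj i w then floatMatrix G S i j - floatMatrix G S w j else 0) =
      ∑ H : SimpleGraph V with IsSRootedForest G H S, if G.Adj i w then
      (if H.Adj i w ∧ i ∈ floatSet (H.deleteEdges {s(i, w)}) S ∧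
        j ∈ floatSet (H.deleteEdges {s(i, w)}) S then (1 : ℤ) else 0) -
      (if H.Adj w i ∧ w ∈ floatSet (H.deleteEdges {s(w, i)}) S ∧
        j ∈ floatSet (H.deleteEdges {s(w, i)}) S then 1 else 0) else 0 := by
    intro w
    by_cases hiw : G.Adj i w
    · simp only [if_pos hiw]
      rw [Finset.sum_sub_distrib, ← sum_starForest_eq_sum_rootedForest hG.isAcyclic hiw,
        ← sum_starForest_eq_sum_rootedForest hG.isAcyclic hiw.symm, floatMatrix, Matrix.of_apply,
        Matrix.of_apply, ← Finset.sum_sub_distrib, ← Finset.sum_sub_distrib]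
      refine Finset.sum_congr rfl fun F _ => ?_
      by_cases h1 : i ∈ floatSet F S <;> by_cases h2 : j ∈ floatSet F S <;>
        by_cases h3 : w ∈ floatSet F S <;> simp [h1, h2, h3]
    · simp [hiw]
  simp_rw [step]
  rw [Finset.sum_comm, Finset.sum_congr rfl fun H hH =>
    sum_adj_rootedForest hG (Finset.mem_filter.mp hH).2 hi j]
  split_ifs <;> simp [rootedCount]

/-- The number of boundary edges of the floating component. -/
theorem sum_boundary_eq (hG : G.IsTree) :
    (∑ F : SimpleGraph V with IsSStarRootedForest G F S, ∑ i, ∑ w,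
      if G.Adj i w ∧ i ∈ floatSet F S ∧ w ∉ floatSet F S then (1 : ℤ) else 0) =
      (Fintype.card V - S.card) * rootedCount G S := by
  have step : ∀ i, (∑ F : SimpleGraph V with IsSStarRootedForest G F S, ∑ w,
      if G.Adj i w ∧ i ∈ floatSet F S ∧ w ∉ floatSet F S then (1 : ℤ) else 0) =
      if i ∉ S then rootedCount G S else 0 := by
    intro i
    by_cases hi : i ∉ S
    · rw [if_pos hi]
      have := sum_adj_floatMatrix hG hi i
      rw [if_pos rfl] at this
      rw [← this, Finset.sum_comm]
      refine Finset.sum_congr rfl fun w _ => ?_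
      rw [floatMatrix, Matrix.of_apply, Matrix.of_apply, ← Finset.sum_sub_distrib]
      by_cases hiw : G.Adj i w
      · rw [if_pos hiw]
        refine Finset.sum_congr rfl fun F _ => ?_
        by_cases h1 : i ∈ floatSet F S <;> by_cases h3 : w ∈ floatSet F S <;> simp [h1, h3, hiw]
      · simp [hiw]
    · rw [if_neg hi]
      rw [not_not] at hi
      refine Finset.sum_eq_zero fun F _ => Finset.sum_eq_zero fun w _ => ?_
      rw [if_neg]
      exact fun h => notMem_floatSet_of_mem hi h.2.1
  rw [Finset.sum_comm, Finset.sum_congr rfl fun i _ => step i, ← Finset.sum_filter,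
    Finset.sum_const, nsmul_eq_mul]
  congr 1
  have : Finset.univ.filter (fun i => i ∉ S) = Sᶜ := by
    ext
    simp
  rw [this, Finset.card_compl, Nat.cast_sub (Finset.card_le_univ S)]

theorem bdeg_eq_sum (hG : G.IsTree) {F : SimpleGraph V} (hF : IsSStarRootedForest G F S) :
    (bdeg G F S : ℤ) =
      ∑ i, ∑ w, if G.Adj i w ∧ i ∈ floatSet F S ∧ w ∉ floatSet F S then 1 else 0 := by
  rw [Finset.sum_comm, bdeg, Set.ncard_eq_toFinset_card', Finset.card_eq_sum_ones, Nat.cast_sum]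
  simp only [Nat.cast_one]
  rw [Finset.sum_congr (Finset.filter_univ_mem _).symm (fun _ _ => rfl), Finset.sum_filter]
  refine Finset.sum_congr rfl fun w _ => ?_
  rw [Finset.sum_boole]
  simp only [Set.mem_toFinset, Set.mem_ofPred_eq]
  split_ifs with h
  · obtain ⟨hw, i, hi, hwi⟩ := h
    rw [eq_comm, Nat.cast_eq_one, Finset.card_eq_one]
    refine ⟨i, ?_⟩
    ext j
    simp only [Finset.mem_filter, Finset.mem_univ, true_and, Finset.mem_singleton]
    refine ⟨fun ⟨hjw, hj, _⟩ => ?_, fun h => h ▸ ⟨hwi.symm, hi, hw⟩⟩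
    by_contra hne
    have h1 := hG.connected.pos_dist_of_ne hne
    have h2 : G.dist j w = 1 := dist_eq_one_iff_adj.mpr hjw
    have h3 := hG.dist_eq_dist_add_one_of_adj j hwi
    have h4 := hG.adj_of_reachable_of_separated hF.1 hwi.symm (hF.2.2.2.2 i hi j hj)
      (by rw [dist_self, dist_eq_one_iff_adj.mpr hwi.symm]; exact one_pos) (by omega)
    exact hw (mem_floatSet_of_reachable hi h4.reachable)
  · rw [eq_comm, Nat.cast_eq_zero, Finset.card_eq_zero, Finset.filter_eq_empty_iff]
    rintro i - ⟨hiw, hi, hw⟩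
    exact h ⟨hw, i, hi, hiw.symm⟩

/-- Summing a function of the distance to `v` over the neighbours of `i`. -/
theorem SimpleGraph.IsTree.sum_adj_dist (hG : G.IsTree) (v i : V) (g : ℕ → ℤ) :
    (∑ w, if G.Adj i w then g (G.dist v w) else 0) =
      G.degree i * g (G.dist v i + 1) -
        if i = v then 0 else g (G.dist v i + 1) - g (G.dist v i - 1) := by
  have h1 := hG.sum_adj_dist_lt v i
  have h2 := G.degree_eq_sum_if_adj (R := ℤ) i
  have h3 : (if i = v then 0 else g (G.dist v i + 1) - g (G.dist v i - 1)) =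
      (if i = v then 0 else 1) * (g (G.dist v i + 1) - g (G.dist v i - 1)) := by
    split_ifs <;> ring
  rw [h3, ← h1, h2, Finset.sum_mul, Finset.sum_mul, ← Finset.sum_sub_distrib]
  refine Finset.sum_congr rfl fun w _ => ?_
  by_cases hiw : G.Adj i w
  · rcases hG.dist_eq_dist_add_one_of_adj v hiw with h | h
    · simp [hiw, h]
    · simp [hiw, h]
  · simp [hiw]

/-- The sum of `2 - deg` over the floating component. -/
theorem sum_two_sub_degree_floatSet (hG : G.IsTree) {F : SimpleGraph V}
    (hF : IsSStarRootedForest G F S) :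
    (∑ i, if i ∈ floatSet F S then 2 - (G.degree i : ℤ) else 0) = 2 - bdeg G F S := by
  obtain ⟨r, hr⟩ := hF.2.2.2.1
  have hclose : ∀ i ∈ floatSet F S, ∀ w, G.Adj i w → G.dist r w < G.dist r i →
      w ∈ floatSet F S := by
    intro i hi w hiw hlt
    refine mem_floatSet_of_reachable hi (hG.adj_of_reachable_of_separated hF.1 hiw
      (hF.2.2.2.2 i hi r hr) ?_ hlt).reachable
    rw [dist_self, dist_eq_one_iff_adj.mpr hiw]
    exact one_pos
  have hcount : (∑ i, ∑ w, if G.Adj i w ∧ i ∈ floatSet F S ∧ w ∈ floatSet F S ∧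
      G.dist r w < G.dist r i then (1 : ℤ) else 0) =
      ∑ i, if i ∈ floatSet F S then (if i = r then 0 else 1) else 0 := by
    refine Finset.sum_congr rfl fun i _ => ?_
    by_cases hi : i ∈ floatSet F S
    · rw [if_pos hi, ← hG.sum_adj_dist_lt r i]
      refine Finset.sum_congr rfl fun w _ => if_congr ?_ rfl rfl
      have := hclose i hi w
      tauto
    · simp [hi]
  have hswap : (∑ i, ∑ w, if G.Adj i w ∧ i ∈ floatSet F S ∧ w ∈ floatSet F S ∧
      G.dist r i < G.dist r w then (1 : ℤ) else 0) =
      ∑ i, if i ∈ floatSet F S then (if i = r then 0 else 1) else 0 := by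
    rw [← hcount, Finset.sum_comm]
    refine Finset.sum_congr rfl fun i _ => Finset.sum_congr rfl fun w _ => if_congr ?_ rfl rfl
    rw [G.adj_comm]
    tauto
  have hdeg : (∑ i, if i ∈ floatSet F S then (G.degree i : ℤ) else 0) =
      bdeg G F S + 2 * ∑ i, if i ∈ floatSet F S then (if i = r then 0 else 1) else 0 := by
    rw [two_mul]
    nth_rewrite 1 [← hcount]
    rw [← hswap, bdeg_eq_sum hG hF]
    simp only [← Finset.sum_add_distrib]
    refine Finset.sum_congr rfl fun i _ => ?_
    rw [G.degree_eq_sum_if_adj]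
    by_cases hi : i ∈ floatSet F S
    · rw [if_pos hi]
      refine Finset.sum_congr rfl fun w _ => ?_
      by_cases hiw : G.Adj i w
      · have := hG.dist_eq_dist_add_one_of_adj r hiw
        by_cases hw : w ∈ floatSet F S
        · simp only [hi, hw, hiw, true_and, not_true, and_false, if_true, if_false]
          split_ifs <;> omega
        · simp [hi, hw, hiw]
      · simp [hiw]
    · simp [hi]
  have hr' : (∑ i, if i ∈ floatSet F S then (if i = r then (0 : ℤ) else 1) else 0) =
      (∑ i, if i ∈ floatSet F S then (1 : ℤ) else 0) - 1 := by
    have : (∑ i, if i = r then (1 : ℤ) else 0) = 1 := by simp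
    rw [eq_sub_iff_add_eq]
    nth_rewrite 2 [← this]
    rw [← Finset.sum_add_distrib]
    refine Finset.sum_congr rfl fun i _ => ?_
    by_cases h : i = r
    · subst h
      simp [hr]
    · simp [h]
  have hsplit : (∑ i, if i ∈ floatSet F S then 2 - (G.degree i : ℤ) else 0) =
      2 * (∑ i, if i ∈ floatSet F S then (1 : ℤ) else 0) -
        ∑ i, if i ∈ floatSet F S then (G.degree i : ℤ) else 0 := by
    rw [Finset.mul_sum, ← Finset.sum_sub_distrib]
    refine Finset.sum_congr rfl fun i _ => ?_
    split_ifs <;> ring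
  rw [hsplit, hdeg, hr']
  ring

theorem floatMatrix_diag {i : V} (hi : i ∉ S) :
    floatMatrix G S i i = rootedCount G (insert i S) := by
  rw [floatMatrix, Matrix.of_apply, Finset.sum_boole, Finset.filter_filter, rootedCount]
  congr 2
  ext F
  simp only [Finset.mem_filter, Finset.mem_univ, true_and, and_self]
  exact IsSStarRootedForest.iff_insert hi

theorem floatMatrix_eq_zero {i : V} (hi : i ∈ S) (j : V) : floatMatrix G S i j = 0 := by
  rw [floatMatrix, Matrix.of_apply]
  exact Finset.sum_eq_zero fun F _ => if_neg fun h => notMem_floatSet_of_mem hi h.1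

theorem floatMatrix_comm (i j : V) : floatMatrix G S i j = floatMatrix G S j i := by
  simp only [floatMatrix, Matrix.of_apply, and_comm]

theorem rootedCount_singleton (hG : G.IsTree) (v : V) : rootedCount G {v} = 1 := by
  rw [rootedCount, Nat.cast_eq_one, Finset.card_eq_one]
  refine ⟨G, ?_⟩
  ext H
  simp [isSRootedForest_singleton_iff hG]

theorem rootedCount_ne_zero (hG : G.IsTree) (hS : S.Nonempty) : rootedCount G S ≠ 0 := by
  obtain ⟨H, hH⟩ := exists_isSRootedForest hG hS
  rw [rootedCount, Nat.cast_ne_zero]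
  exact Finset.card_ne_zero_of_mem (a := H) (by simpa using hH)

/-! ### The bordered distance matrix -/

theorem Matrix.det_of_ite_mem {R : Type*} [CommRing R] (M : Matrix V V R) (S : Finset V) (c : R) :
    Matrix.det (Matrix.of fun i j => if j ∈ S then M i j else if i = j then c else 0) =
      c ^ (Fintype.card V - S.card) *
        Matrix.det (Matrix.of fun i j : {x // x ∈ S} => M i.val j.val) := by
  have h1 : Matrix.toSquareBlockProp
      (Matrix.of fun i j => if j ∈ S then M i j else if i = j then c else 0) (fun i => i ∈ S) =
      Matrix.of fun i j : {x // x ∈ S} => M i.val j.val := by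
    ext i j
    rw [Matrix.toSquareBlockProp_def, Matrix.of_apply, Matrix.of_apply, Matrix.of_apply,
      if_pos j.2]
  have h2 : Matrix.toSquareBlockProp
      (Matrix.of fun i j => if j ∈ S then M i j else if i = j then c else 0) (fun i => ¬ i ∈ S) =
      Matrix.diagonal fun _ => c := by
    ext i j
    rw [Matrix.toSquareBlockProp_def, Matrix.of_apply, Matrix.of_apply, if_neg j.2,
      Matrix.diagonal_apply, if_congr Subtype.ext_iff.symm rfl rfl]
  rw [Matrix.twoBlockTriangular_det' _ (fun i => i ∈ S), mul_comm, h1, h2, Matrix.det_diagonal,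
    Finset.prod_const, Finset.card_univ, Fintype.card_subtype_compl, Fintype.card_coe]
  · congr!
  · intro i hi j hj
    rw [Matrix.of_apply, if_neg hj, if_neg]
    rintro rfl
    exact hj hi

theorem SimpleGraph.lapMatrix_mul_apply (N : Matrix V V ℤ) (i j : V) :
    (G.lapMatrix ℤ * N) i j = ∑ w, if G.Adj i w then N i j - N w j else 0 := by
  have h := G.lapMatrix_mulVec_apply (R := ℤ) i (fun k => N k j)
  have h' : (G.lapMatrix ℤ * N) i j = (G.lapMatrix ℤ).mulVec (fun k => N k j) i := rfl
  rw [h', h, G.degree_eq_sum_if_adj, Finset.sum_mul, neighborFinset_eq_filter, Finset.sum_filter,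
    ← Finset.sum_sub_distrib]
  refine Finset.sum_congr rfl fun w _ => ?_
  split_ifs <;> ring

theorem SimpleGraph.lapMatrix_comm (i j : V) : G.lapMatrix ℤ i j = G.lapMatrix ℤ j i :=
  (G.isSymm_lapMatrix ℤ).apply j i

/-- The distance matrix of a graph. -/
noncomputable def distMatrix (G : SimpleGraph V) : Matrix V V ℤ :=
  Matrix.of fun i j => (G.dist i j : ℤ)

theorem lapMatrix_mul_distMatrix (hG : G.IsTree) (i j : V) :
    (G.lapMatrix ℤ * distMatrix G) i j = 2 - G.degree i - if i = j then 2 else 0 := by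
  have h := hG.sum_adj_dist j i (fun k => (k : ℤ))
  have h2 := G.degree_eq_sum_if_adj (R := ℤ) i
  have h3 : (∑ w, if G.Adj i w then (G.dist j i : ℤ) - G.dist j w else 0) =
      G.degree i * (G.dist j i : ℤ) - ∑ w, if G.Adj i w then (G.dist j w : ℤ) else 0 := by
    rw [h2, Finset.sum_mul, ← Finset.sum_sub_distrib]
    refine Finset.sum_congr rfl fun w _ => ?_
    split_ifs <;> ring
  rw [SimpleGraph.lapMatrix_mul_apply]
  simp only [distMatrix, Matrix.of_apply, @dist_comm _ G _ j]
  rw [h3, h]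
  split_ifs with hij
  · push_cast
    ring
  · have := hG.connected.pos_dist_of_ne (Ne.symm hij)
    rw [Nat.cast_sub this]
    push_cast
    ring

theorem distMatrix_mul_lapMatrix (hG : G.IsTree) (i j : V) :
    (distMatrix G * G.lapMatrix ℤ) i j = 2 - G.degree j - if i = j then 2 else 0 := by
  rw [if_congr eq_comm rfl rfl, ← lapMatrix_mul_distMatrix hG, Matrix.mul_apply, Matrix.mul_apply]
  refine Finset.sum_congr rfl fun k _ => ?_
  rw [SimpleGraph.lapMatrix_comm, mul_comm]
  simp [distMatrix, dist_comm]

theorem sum_dist_moment (hG : G.IsTree) (v : V) (g : ℕ → ℤ) :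
    (∑ i, (G.degree i * (g (G.dist v i + 1) - g (G.dist v i)) -
      if i = v then 0 else g (G.dist v i + 1) - g (G.dist v i - 1))) = 0 := by
  have h : (∑ i, ∑ w, if G.Adj i w then g (G.dist v w) else 0) =
      ∑ i, G.degree i * g (G.dist v i) := by
    rw [Finset.sum_comm]
    refine Finset.sum_congr rfl fun i _ => ?_
    rw [G.degree_eq_sum_if_adj, Finset.sum_mul]
    refine Finset.sum_congr rfl fun w _ => ?_
    rw [if_congr (G.adj_comm w i) rfl rfl]
    split_ifs <;> ring
  rw [Finset.sum_congr rfl fun i _ => hG.sum_adj_dist v i g, ← sub_eq_zero,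
    ← Finset.sum_sub_distrib] at h
  refine Eq.trans (Finset.sum_congr rfl fun i _ => ?_) h
  ring

theorem sum_two_sub_degree (hG : G.IsTree) : (∑ i, (2 - (G.degree i : ℤ))) = 2 := by
  obtain ⟨v⟩ := hG.connected.nonempty
  have h := sum_dist_moment hG v (fun k => (k : ℤ))
  have h1 : (∑ i : V, if i = v then (2 : ℤ) else 0) = 2 := by simp
  rw [← neg_eq_zero, ← Finset.sum_neg_distrib] at h
  refine Eq.trans (sub_eq_zero.mp ?_) h1
  rw [← Finset.sum_sub_distrib]
  refine Eq.trans (Finset.sum_congr rfl fun i _ => ?_) h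
  split_ifs with hi
  · push_cast
    ring
  · have := hG.connected.pos_dist_of_ne (Ne.symm hi)
    rw [Nat.cast_sub this]
    push_cast
    ring

theorem sum_dist_mul_two_sub_degree (hG : G.IsTree) (v : V) :
    (∑ i, (G.dist v i : ℤ) * (2 - (G.degree i : ℤ))) = Fintype.card V - 1 := by
  have h := sum_dist_moment hG v (fun k => (k : ℤ) ^ 2)
  have h2 := sum_two_sub_degree hG
  have h3 : (∑ i : V, (2 : ℤ)) = 2 * Fintype.card V := by simp [mul_comm]
  have h4 : (∑ i, (G.degree i * (((G.dist v i + 1 : ℕ) : ℤ) ^ 2 - (G.dist v i : ℤ) ^ 2) -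
      if i = v then 0 else ((G.dist v i + 1 : ℕ) : ℤ) ^ 2 - ((G.dist v i - 1 : ℕ) : ℤ) ^ 2)) =
      ∑ i, (2 - (2 - (G.degree i : ℤ)) - 2 * ((G.dist v i : ℤ) * (2 - (G.degree i : ℤ)))) := by
    refine Finset.sum_congr rfl fun i _ => ?_
    split_ifs with hi
    · subst hi
      simp
    · have := hG.connected.pos_dist_of_ne (Ne.symm hi)
      rw [Nat.cast_sub this]
      push_cast
      ring
  rw [h4, Finset.sum_sub_distrib, Finset.sum_sub_distrib, h2, h3, ← Finset.mul_sum] at h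
  linarith

/-- The Laplacian matrix with the columns indexed by `S` replaced by unit vectors. -/
noncomputable def groundedLap (G : SimpleGraph V) (S : Finset V) : Matrix V V ℤ :=
  Matrix.of fun i j => if j ∈ S then (if i = j then 1 else 0) else G.lapMatrix ℤ i j

theorem mul_groundedLap_apply (N : Matrix V V ℤ) (i j : V) :
    (N * groundedLap G S) i j = if j ∈ S then N i j else (N * G.lapMatrix ℤ) i j := by
  simp only [groundedLap, Matrix.mul_apply, Matrix.of_apply]
  split_ifs <;> simp

theorem floatMatrix_mul_groundedLap (hG : G.IsTree) (i j : V) :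
    (floatMatrix G S * groundedLap G S) i j =
      if j ∈ S then 0 else if i = j then rootedCount G S else 0 := by
  rw [mul_groundedLap_apply]
  split_ifs with hj hij
  · rw [floatMatrix_comm, floatMatrix_eq_zero hj]
  all_goals
    have : (floatMatrix G S * G.lapMatrix ℤ) i j = (G.lapMatrix ℤ * floatMatrix G S) j i := by
      rw [Matrix.mul_apply, Matrix.mul_apply]
      refine Finset.sum_congr rfl fun k _ => ?_
      rw [SimpleGraph.lapMatrix_comm, floatMatrix_comm, mul_comm]
    rw [this, SimpleGraph.lapMatrix_mul_apply, sum_adj_floatMatrix hG hj]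
  · rw [if_pos hij.symm]
  · rw [if_neg (Ne.symm hij)]

theorem adjugate_groundedLap_diag (i : V) :
    (groundedLap G S).adjugate i i = (groundedLap G (insert i S)).det := by
  rw [← Matrix.transpose_apply (groundedLap G S).adjugate, Matrix.adjugate_transpose,
    Matrix.adjugate_apply, Matrix.updateRow_transpose, Matrix.det_transpose]
  congr 1
  ext a b
  by_cases hb : b = i
  · subst hb
    simp [groundedLap, Pi.single_apply]
  · simp [groundedLap, hb]

theorem rootedCount_univ : rootedCount G Finset.univ = 1 := by
  rw [rootedCount, Nat.cast_eq_one, Finset.card_eq_one]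
  refine ⟨⊥, ?_⟩
  ext H
  simp only [Finset.mem_filter, Finset.mem_univ, true_and, Finset.mem_singleton]
  constructor
  · rintro ⟨-, -, hinj, -⟩
    ext a b
    simp only [bot_adj, iff_false]
    exact fun h => h.ne (hinj a (Finset.mem_univ a) b (Finset.mem_univ b) h.reachable)
  · rintro rfl
    refine ⟨bot_le, isAcyclic_bot, fun s _ t _ h => by simpa using h,
      fun v => ⟨v, Finset.mem_univ v, Reachable.refl _⟩⟩

/-- The matrix-forest theorem for trees. -/
theorem det_groundedLap (hG : G.IsTree) (hS : S.Nonempty) :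
    (groundedLap G S).det = rootedCount G S := by
  induction hk : Sᶜ.card generalizing S with
  | zero =>
    rw [Finset.card_eq_zero, Finset.compl_eq_empty_iff] at hk
    subst hk
    have : groundedLap G Finset.univ = 1 := by
      ext i j
      simp [groundedLap, Matrix.one_apply]
    rw [this, Matrix.det_one, rootedCount_univ]
  | succ k ih =>
    obtain ⟨i, hi⟩ : Sᶜ.Nonempty := by
      rw [← Finset.card_pos]
      omega
    have hi' := hi
    rw [Finset.mem_compl] at hi
    have h1 := ih (Finset.insert_nonempty i S) (by
      rw [Finset.compl_insert, Finset.card_erase_of_mem hi', hk, Nat.add_sub_cancel])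
    have h2 : (floatMatrix G S * groundedLap G S * (groundedLap G S).adjugate) i i =
        floatMatrix G S i i * (groundedLap G S).det := by
      rw [Matrix.mul_assoc, Matrix.mul_adjugate, Matrix.mul_smul, Matrix.mul_one,
        Matrix.smul_apply, smul_eq_mul, mul_comm]
    rw [Matrix.mul_apply, Finset.sum_eq_single i, floatMatrix_mul_groundedLap hG, if_neg hi,
      if_pos rfl, adjugate_groundedLap_diag, h1, floatMatrix_diag hi, mul_comm] at h2
    · exact (mul_left_cancel₀ (rootedCount_ne_zero hG (Finset.insert_nonempty i S)) h2).symm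
    · intro j _ hj
      rw [floatMatrix_mul_groundedLap hG, if_neg (Ne.symm hj), ite_self, zero_mul]
    · simp

/-- The distance matrix bordered by ones. -/
noncomputable def borderedDist (G : SimpleGraph V) : Matrix (V ⊕ Unit) (V ⊕ Unit) ℤ :=
  Matrix.fromBlocks (distMatrix G) (Matrix.of fun _ _ => 1) (Matrix.of fun _ _ => 1) 0

/-- The grounded Laplacian bordered by the vector `deg - 2`, grounded below as well. -/
noncomputable def borderedLap (G : SimpleGraph V) (S : Finset V) :
    Matrix (V ⊕ Unit) (V ⊕ Unit) ℤ :=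
  Matrix.fromBlocks (groundedLap G S) (Matrix.of fun i _ => -(2 - (G.degree i : ℤ)))
    (Matrix.of fun _ j => if j ∈ S then 0 else -(2 - (G.degree j : ℤ)))
    (Matrix.of fun _ _ => (Fintype.card V : ℤ) - 1)

theorem distMatrix_mul_groundedLap_add (hG : G.IsTree) :
    distMatrix G * groundedLap G S + (Matrix.of fun _ _ => 1 : Matrix V Unit ℤ) *
      (Matrix.of fun _ j => if j ∈ S then 0 else -(2 - (G.degree j : ℤ)) : Matrix Unit V ℤ) =
    Matrix.of fun i j => if j ∈ S then distMatrix G i j else if i = j then -2 else 0 := by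
  ext i j
  rw [Matrix.add_apply, mul_groundedLap_apply, distMatrix_mul_lapMatrix hG]
  simp only [Matrix.mul_apply, Matrix.of_apply, Finset.univ_unique, Finset.sum_singleton]
  split_ifs <;> ring

theorem det_borderedDist_mul_det_borderedLap (hG : G.IsTree) :
    (borderedDist G).det * (borderedLap G S).det =
      (-2) ^ (Fintype.card V - S.card + 1) *
        Matrix.det (Matrix.of fun i j : {x // x ∈ S} => (G.dist i.val j.val : ℤ)) := by
  have h1 : distMatrix G * (Matrix.of fun i _ => -(2 - (G.degree i : ℤ)) : Matrix V Unit ℤ) +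
      (Matrix.of fun _ _ => 1 : Matrix V Unit ℤ) *
        (Matrix.of fun _ _ => (Fintype.card V : ℤ) - 1 : Matrix Unit Unit ℤ) = 0 := by
    ext i j
    have := sum_dist_mul_two_sub_degree hG i
    simp only [Matrix.add_apply, Matrix.mul_apply, distMatrix, Matrix.of_apply, mul_neg,
      Finset.sum_neg_distrib, this]
    simp
  have h2 : (Matrix.of fun _ _ => 1 : Matrix Unit V ℤ) *
      (Matrix.of fun i _ => -(2 - (G.degree i : ℤ)) : Matrix V Unit ℤ) +
      (0 : Matrix Unit Unit ℤ) *
        (Matrix.of fun _ _ => (Fintype.card V : ℤ) - 1 : Matrix Unit Unit ℤ) =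
      Matrix.of fun _ _ => -2 := by
    ext i j
    have := sum_two_sub_degree hG
    simp only [Matrix.zero_mul, add_zero, Matrix.mul_apply, Matrix.of_apply, one_mul,
      Finset.sum_neg_distrib, this]
  rw [← Matrix.det_mul, borderedDist, borderedLap, Matrix.fromBlocks_multiply,
    distMatrix_mul_groundedLap_add hG, h1, h2, Matrix.det_fromBlocks_zero₁₂,
    Matrix.det_of_ite_mem, Matrix.det_unique (n := Unit), pow_succ]
  simp only [Matrix.of_apply, distMatrix]
  ring

theorem det_borderedDist (hG : G.IsTree) :
    (borderedDist G).det = -(-2) ^ (Fintype.card V - 1) := by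
  obtain ⟨v⟩ := hG.connected.nonempty
  set C : Matrix (V ⊕ Unit) (V ⊕ Unit) ℤ := Matrix.fromBlocks (groundedLap G {v}) 0
    (Matrix.of fun _ j => if j ∈ ({v} : Finset V) then 0 else -(2 - (G.degree j : ℤ))) 1 with hC
  have hdet : C.det = 1 := by
    rw [hC, Matrix.det_fromBlocks_zero₁₂, det_groundedLap hG (Finset.singleton_nonempty v),
      rootedCount_singleton hG, Matrix.det_one, mul_one]
  have hlow : (Matrix.of fun _ _ => 1 : Matrix Unit V ℤ) * groundedLap G {v} =
      Matrix.of fun _ j => if j = v then 1 else 0 := by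
    ext i j
    have h := congrFun (G.lapMatrix_mulVec_const_eq_zero (R := ℤ)) j
    simp only [Matrix.mulVec, dotProduct, mul_one, Pi.zero_apply] at h
    simp only [Matrix.mul_apply, groundedLap, Matrix.of_apply, one_mul, Finset.mem_singleton]
    split_ifs with hj
    · simp
    · rw [← h]
      exact Finset.sum_congr rfl fun k _ => SimpleGraph.lapMatrix_comm k j
  have hprod : borderedDist G * C = Matrix.fromBlocks
      (Matrix.of fun i j => if j ∈ ({v} : Finset V) then distMatrix G i j
        else if i = j then -2 else 0)
      (Matrix.of fun _ _ => 1) (Matrix.of fun _ j => if j = v then 1 else 0) 0 := by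
    rw [borderedDist, hC, Matrix.fromBlocks_multiply, distMatrix_mul_groundedLap_add hG]
    simp [hlow]
  have hswap : (borderedDist G * C).submatrix id (Equiv.swap (Sum.inl v) (Sum.inr ())) =
      Matrix.fromBlocks
      (Matrix.of fun i j => if j ∈ ({v} : Finset V) then (Matrix.of fun _ _ => 1) i j
        else if i = j then -2 else 0)
      (Matrix.of fun i _ => distMatrix G i v) 0 1 := by
    rw [hprod]
    ext i j
    rcases i with i | i <;> rcases j with j | j
    · by_cases hj : j = v <;> simp [Equiv.swap_apply_def, hj]
    · simp
    · by_cases hj : j = v <;> simp [Equiv.swap_apply_def, hj]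
    · simp
  have h := Matrix.det_permute' (Equiv.swap (Sum.inl v) (Sum.inr ())) (borderedDist G * C)
  rw [hswap, Matrix.det_fromBlocks_zero₂₁, Matrix.det_of_ite_mem, Matrix.det_mul, hdet,
    Equiv.Perm.sign_swap (by simp), Finset.card_singleton] at h
  have hone : Matrix.det (Matrix.of fun i j : {x // x ∈ ({v} : Finset V)} =>
      (Matrix.of fun _ _ => 1 : Matrix V V ℤ) i.val j.val) = 1 := by
    rw [Matrix.det_eq_elem_of_subsingleton _ ⟨v, Finset.mem_singleton_self v⟩]
    rfl
  rw [hone] at h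
  simp at h
  linarith

theorem det_borderedLap (hG : G.IsTree) (hS : S.Nonempty) :
    (borderedLap G S).det = rootedCount G S * (Fintype.card V - 1) -
      ∑ i, ∑ j, (2 - (G.degree i : ℤ)) * floatMatrix G S i j * (2 - (G.degree j : ℤ)) := by
  set R : Matrix (V ⊕ Unit) (V ⊕ Unit) ℤ := Matrix.fromBlocks 1 0
    ((Matrix.of fun _ j => 2 - (G.degree j : ℤ) : Matrix Unit V ℤ) * floatMatrix G S)
    (Matrix.of fun _ _ => rootedCount G S) with hR
  have hdet : R.det = rootedCount G S := by
    rw [hR, Matrix.det_fromBlocks_zero₁₂, Matrix.det_one, one_mul, Matrix.det_unique,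
      Matrix.of_apply]
  have h1 : (Matrix.of fun _ j => 2 - (G.degree j : ℤ) : Matrix Unit V ℤ) * floatMatrix G S *
      groundedLap G S + (Matrix.of fun _ _ => rootedCount G S : Matrix Unit Unit ℤ) *
      (Matrix.of fun _ j => if j ∈ S then 0 else -(2 - (G.degree j : ℤ)) : Matrix Unit V ℤ) = 0 := by
    ext i j
    rw [Matrix.mul_assoc, Matrix.add_apply, Matrix.mul_apply]
    simp only [floatMatrix_mul_groundedLap hG]
    by_cases hj : j ∈ S
    · simp [hj, Matrix.mul_apply]
    · simp [hj, Matrix.mul_apply]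
      ring
  have h := congrArg Matrix.det (Matrix.fromBlocks_multiply 1 0
    ((Matrix.of fun _ j => 2 - (G.degree j : ℤ) : Matrix Unit V ℤ) * floatMatrix G S)
    (Matrix.of fun _ _ => rootedCount G S : Matrix Unit Unit ℤ) (groundedLap G S)
    (Matrix.of fun i _ => -(2 - (G.degree i : ℤ)) : Matrix V Unit ℤ)
    (Matrix.of fun _ j => if j ∈ S then 0 else -(2 - (G.degree j : ℤ)))
    (Matrix.of fun _ _ => (Fintype.card V : ℤ) - 1))
  rw [h1, ← hR, Matrix.det_mul, hdet, ← borderedLap, Matrix.det_fromBlocks_zero₂₁, Matrix.one_mul,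
    Matrix.zero_mul, add_zero, det_groundedLap hG hS, Matrix.det_unique (n := Unit)] at h
  rw [mul_left_cancel₀ (rootedCount_ne_zero hG hS) h, Matrix.add_apply, Matrix.mul_apply,
    Matrix.mul_apply, Finset.sum_comm]
  simp only [Matrix.mul_apply, Matrix.of_apply, Finset.sum_mul, mul_neg, Finset.sum_neg_distrib,
    Finset.univ_unique, Finset.sum_singleton]
  ring

theorem sum_floatMatrix_eq (hG : G.IsTree) :
    (∑ i, ∑ j, (2 - (G.degree i : ℤ)) * floatMatrix G S i j * (2 - (G.degree j : ℤ))) =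
      ∑ F : SimpleGraph V with IsSStarRootedForest G F S, (2 - (bdeg G F S : ℤ)) ^ 2 := by
  have h : ∀ F ∈ Finset.univ.filter (fun F : SimpleGraph V => IsSStarRootedForest G F S),
      (2 - (bdeg G F S : ℤ)) ^ 2 = ∑ i, ∑ j, (2 - (G.degree i : ℤ)) *
        (if i ∈ floatSet F S ∧ j ∈ floatSet F S then 1 else 0) * (2 - (G.degree j : ℤ)) := by
    intro F hF
    rw [← sum_two_sub_degree_floatSet hG (Finset.mem_filter.mp hF).2, sq, Finset.sum_mul_sum]
    refine Finset.sum_congr rfl fun i _ => Finset.sum_congr rfl fun j _ => ?_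
    by_cases hi : i ∈ floatSet F S <;> by_cases hj : j ∈ floatSet F S <;> simp [hi, hj]
  rw [Finset.sum_congr rfl h, eq_comm, Finset.sum_comm]
  refine Finset.sum_congr rfl fun i _ => ?_
  rw [Finset.sum_comm]
  refine Finset.sum_congr rfl fun j _ => ?_
  rw [floatMatrix, Matrix.of_apply, Finset.mul_sum, Finset.sum_mul]

end Forests

theorem distance_matrix_principal_minor
    {V : Type*} [Fintype V] (G : SimpleGraph V) (hG : G.IsTree)
    (S : Finset V) (m : ℕ) (hm : S.card = m) (hm2 : 2 ≤ m) :
    Matrix.det (Matrix.of fun i j : {x // x ∈ S} => (G.dist i.val j.val : ℤ)) =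
      (-1) ^ (m - 1) * 2 ^ (m - 2) *
        (((m : ℤ) - 1) *
            (Finset.univ.filter (fun H : SimpleGraph V => IsSRootedForest G H S)).card -
          ∑ H ∈ Finset.univ.filter (fun H : SimpleGraph V => IsSStarRootedForest G H S),
            ((bdeg G H S : ℤ) - 1) * ((bdeg G H S : ℤ) - 4)) := by
  have hS : S.Nonempty := Finset.card_pos.mp (by omega)
  have hcard := Finset.card_le_univ S
  have h := det_borderedDist_mul_det_borderedLap hG (S := S)
  have hb := sum_boundary_eq hG (S := S)
  rw [Finset.sum_congr rfl fun F hF => (bdeg_eq_sum hG (Finset.mem_filter.mp hF).2).symm] at hb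
  rw [det_borderedDist hG, det_borderedLap hG hS, sum_floatMatrix_eq hG] at h
  have hsum : (∑ F : SimpleGraph V with IsSStarRootedForest G F S,
      ((bdeg G F S : ℤ) - 1) * ((bdeg G F S : ℤ) - 4)) =
      (∑ F : SimpleGraph V with IsSStarRootedForest G F S, (2 - (bdeg G F S : ℤ)) ^ 2) -
        ∑ F : SimpleGraph V with IsSStarRootedForest G F S, (bdeg G F S : ℤ) := by
    rw [← Finset.sum_sub_distrib]
    refine Finset.sum_congr rfl fun F _ => ?_
    ring
  have hexp : Fintype.card V - 1 = (Fintype.card V - S.card + 1) + (m - 2) := by omega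
  have hm1 : m - 1 = (m - 2) + 1 := by omega
  have hpow : ((-1 : ℤ)) ^ (m - 1) * 2 ^ (m - 2) = -(-2) ^ (m - 2) := by
    rw [hm1, pow_succ, mul_right_comm, ← mul_pow]
    norm_num
  rw [hexp, pow_add, hm] at h
  rw [hm] at hb
  rw [hsum, hb, hpow]
  refine mul_left_cancel₀ (pow_ne_zero (Fintype.card V - m + 1) (by norm_num : (-2 : ℤ) ≠ 0)) ?_
  rw [← h, rootedCount]
  ring
end

section
/- (Graham–Pollak) Let T be a finite tree on n ≥ 2 vertices and let D be its distance matrix. Then det D = (-1)^{n-1} · (n-1) · 2^{n-2}. -/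
open scoped Classical

/-- A matrix whose off-diagonal entries vanish unless the grading `b` strictly increases has
determinant the product of its diagonal entries. -/
theorem Matrix.det_of_strictly_graded {V R : Type*} [Fintype V] [DecidableEq V] [CommRing R]
    (M : Matrix V V R) (b : V → ℕ) (h : ∀ i j, i ≠ j → b j ≤ b i → M i j = 0) :
    M.det = ∏ i, M i i := by
  have hM : M.BlockTriangular b := fun i j hij ↦ h i j (by rintro rfl; simp at hij) hij.le
  have hdiag : ∀ k, (M.toSquareBlock b k).det = ∏ i : {i // b i = k}, M i i := by
    intro k
    have : M.toSquareBlock b k = Matrix.diagonal fun i : {i // b i = k} ↦ M i i := by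
      ext i j
      by_cases hij : i = j
      · subst hij
        simp [Matrix.toSquareBlock_def]
      · rw [Matrix.diagonal_apply_ne _ hij]
        exact h i j (fun e ↦ hij (Subtype.ext e)) (by rw [i.2, j.2])
    rw [this, Matrix.det_diagonal]
  rw [hM.det, Finset.prod_congr rfl fun k _ ↦ hdiag k]
  rw [← Finset.prod_fiberwise_of_maps_to (s := Finset.univ) (t := Finset.univ.image b) (g := b)
    (fun i _ ↦ Finset.mem_image_of_mem _ (Finset.mem_univ i))]
  refine Finset.prod_congr rfl fun k _ ↦ ?_
  exact (Finset.prod_subtype (p := fun i ↦ b i = k) (Finset.univ.filter fun i ↦ b i = k)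
    (fun i ↦ by simp) fun i ↦ M i i).symm

/-- The determinant of `-2 • 1` bordered by ones with a zero corner at `r`, doubled. -/
theorem Matrix.two_mul_det_bordered {V : Type*} [Fintype V] [DecidableEq V] (r : V) :
    2 * (Matrix.of fun i j : V ↦
      if i = r then (if j = r then 0 else 1)
      else if j = r then 1 else if i = j then (-2 : ℤ) else 0).det =
      ((Fintype.card V : ℤ) - 1) * (-2) ^ (Fintype.card V - 1) := by
  set M : Matrix V V ℤ := Matrix.of fun i j : V ↦
      if i = r then (if j = r then 0 else 1)
      else if j = r then 1 else if i = j then (-2 : ℤ) else 0 with hM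
  let L : Matrix V V ℤ := Matrix.of fun i j ↦
    if i = r then (if j = r then 2 else 1) else if i = j then 1 else 0
  have hL : L.det = 2 := by
    rw [L.det_of_strictly_graded (fun i ↦ if i = r then 0 else 1)]
    · rw [Fintype.prod_eq_single r fun i hi ↦ by simp [L, hi]]
      simp [L]
    · intro i j hij hb
      by_cases hi : i = r
      · subst hi
        simp [hij.symm] at hb
      · simp [L, hi, hij]
  have hrow : ∀ i j, i ≠ r → (L * M) i j = M i j := by
    intro i j hi
    simp [Matrix.mul_apply, L, hi]
  have hr : ∀ j, (L * M) r j = if j = r then (Fintype.card V : ℤ) - 1 else 0 := by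
    intro j
    rw [Matrix.mul_apply, ← Finset.add_sum_erase _ _ (Finset.mem_univ r)]
    by_cases hj : j = r
    · rw [Finset.sum_congr rfl (g := fun _ ↦ (1 : ℤ))]
      · have : 1 ≤ Fintype.card V := Fintype.card_pos_iff.mpr ⟨r⟩
        simp [hj, M, L, Finset.card_erase_of_mem, this]
      · intro i hi
        simp [L, M, Finset.ne_of_mem_erase hi, hj]
    · rw [Finset.sum_eq_single j]
      · simp [L, M, hj]
      · intro i hi hij
        simp [L, M, Finset.ne_of_mem_erase hi, hj, hij]
      · simp [hj]
  have hN : (L * M).det = ((Fintype.card V : ℤ) - 1) * (-2) ^ (Fintype.card V - 1) := by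
    rw [(L * M).det_of_strictly_graded (fun i ↦ if i = r then 1 else 0)]
    · rw [← Finset.mul_prod_erase _ _ (Finset.mem_univ r), hr, if_pos rfl,
        Finset.prod_congr rfl (g := fun _ ↦ (-2 : ℤ))]
      · simp [Finset.card_erase_of_mem]
      · intro i hi
        have hi := Finset.ne_of_mem_erase hi
        rw [hrow i i hi]
        simp [M, hi]
    · intro i j hij hb
      by_cases hi : i = r
      · subst hi
        rw [hr, if_neg hij.symm]
      · have hj : j ≠ r := by
          rintro rfl
          simp [hi] at hb
        rw [hrow i j hi]
        simp [M, hi, hj, hij]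
  rw [← hN, Matrix.det_mul, hL]

namespace SimpleGraph

variable {V : Type*} {G : SimpleGraph V}

theorem Connected.exists_adj_dist_eq_add_one (hG : G.Connected) {r v : V} (h : v ≠ r) :
    ∃ w, G.Adj v w ∧ G.dist r v = G.dist r w + 1 := by
  obtain ⟨p, hp⟩ := hG.exists_walk_length_eq_dist v r
  cases p with
  | nil => exact absurd rfl h
  | @cons _ w _ hvw q =>
    refine ⟨w, hvw, ?_⟩
    rw [Walk.length_cons, dist_comm] at hp
    have h₁ := dist_le q
    have h₂ := hG.dist_triangle (u := r) (v := w) (w := v)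
    rw [dist_eq_one_iff_adj.mpr hvw.symm] at h₂
    rw [dist_comm] at h₁
    omega

/-- In a tree, the neighbour of `v` lying closer to a vertex `u` is unique. -/
theorem IsTree.eq_of_adj_of_dist_eq (hG : G.IsTree) {u v x y : V} (hx : G.Adj v x)
    (hy : G.Adj v y) (hdx : G.dist u v = G.dist u x + 1) (hdy : G.dist u v = G.dist u y + 1) :
    x = y := by
  obtain ⟨p, hp⟩ := hG.connected.exists_walk_length_eq_dist x u
  obtain ⟨q, hq⟩ := hG.connected.exists_walk_length_eq_dist y u
  have hp' : (Walk.cons hx p).IsPath := Walk.isPath_of_length_eq_dist _ (by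
    rw [Walk.length_cons, hp, dist_comm, dist_comm (u := v), hdx])
  have hq' : (Walk.cons hy q).IsPath := Walk.isPath_of_length_eq_dist _ (by
    rw [Walk.length_cons, hq, dist_comm, dist_comm (u := v), hdy])
  have h := (hG.existsUnique_path v u).unique hp' hq'
  simpa using congrArg Walk.snd h

/-- In a tree, the two endpoints of an edge `vv'` are matched by the endpoints of an edge `uu'`
lying on opposite sides of it. -/
theorem IsTree.eq_of_adj_of_adj_of_dist_eq (hG : G.IsTree) {u u' v v' : V}
    (hu : G.Adj u u') (hv : G.Adj v v') (h₁ : G.dist u v' = G.dist u v + 1)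
    (h₂ : G.dist u' v = G.dist u' v' + 1) : u = v := by
  by_contra huv
  obtain ⟨x, hvx, hx⟩ := hG.connected.exists_adj_dist_eq_add_one (Ne.symm huv)
  have hne : x ≠ v' := by
    rintro rfl
    omega
  have t₁ := hG.connected.dist_triangle (u := u') (v := u) (w := x)
  have t₂ := hG.connected.dist_triangle (u := u) (v := u') (w := v')
  rw [dist_eq_one_iff_adj.mpr hu.symm] at t₁
  rw [dist_eq_one_iff_adj.mpr hu] at t₂
  have t₃ := hG.dist_eq_dist_add_one_of_adj u' hvx
  exact hne (hG.eq_of_adj_of_dist_eq hvx hv (u := u') (by omega) h₂)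

/-- In a tree, distances have vanishing mixed second difference along two different edges. -/
theorem IsTree.dist_sub_dist_eq (hG : G.IsTree) {u u' v v' : V}
    (hu : G.Adj u u') (hv : G.Adj v v') (huv : u ≠ v) (huv' : u ≠ v') :
    (G.dist u v : ℤ) - G.dist u v' = G.dist u' v - G.dist u' v' := by
  have h₁ := hG.eq_of_adj_of_adj_of_dist_eq hu hv
  have h₂ := hG.eq_of_adj_of_adj_of_dist_eq hu hv.symm
  have h₃ := hG.dist_eq_dist_add_one_of_adj u hv
  have h₄ := hG.dist_eq_dist_add_one_of_adj u' hv
  rcases h₃ with h₃ | h₃ <;> rcases h₄ with h₄ | h₄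
  · omega
  · exact absurd (h₂ h₃ h₄) huv'
  · exact absurd (h₁ h₃ h₄) huv
  · omega

end SimpleGraph

theorem graham_pollak
    {V : Type*} [Fintype V] (G : SimpleGraph V) (hG : G.IsTree)
    (n : ℕ) (hn : Fintype.card V = n) (hn2 : 2 ≤ n) :
    Matrix.det (Matrix.of fun i j : V => (G.dist i j : ℤ)) =
      (-1) ^ (n - 1) * ((n : ℤ) - 1) * 2 ^ (n - 2) := by
  obtain ⟨r⟩ := hG.connected.nonempty
  have hpar : ∀ v, ∃ w, v ≠ r → G.Adj v w ∧ G.dist r v = G.dist r w + 1 := fun v ↦ by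
    by_cases hv : v = r
    · exact ⟨r, fun h ↦ absurd hv h⟩
    · obtain ⟨w, hw⟩ := hG.connected.exists_adj_dist_eq_add_one hv
      exact ⟨w, fun _ ↦ hw⟩
  choose p hp using hpar
  set D : Matrix V V ℤ := Matrix.of fun i j : V => (G.dist i j : ℤ) with hD
  let P : Matrix V V ℤ := Matrix.of fun i v ↦
    (if i = v then 1 else 0) - if v = r then 0 else if i = p v then 1 else 0
  have hP : P.det = 1 := by
    rw [P.det_of_strictly_graded (G.dist r)]
    · refine Finset.prod_eq_one fun v _ ↦ ?_
      by_cases hv : v = r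
      · simp [P, hv]
      · simp [P, hv, (hp v hv).1.ne]
    · intro i v hiv hd
      by_cases hv : v = r
      · simp [P, hv, hv ▸ hiv]
      · have : i ≠ p v := by
          rintro rfl
          have := (hp v hv).2
          omega
        simp [P, hiv, this]
  have hmul : ∀ (A : Matrix V V ℤ) (i v : V),
      (A * P) i v = A i v - if v = r then 0 else A i (p v) := by
    intro A i v
    by_cases hv : v = r <;> simp [Matrix.mul_apply, P, mul_sub, hv]
  have hM : P.transpose * (D * P) = Matrix.of fun i j : V ↦
      if i = r then (if j = r then 0 else 1)
      else if j = r then 1 else if i = j then (-2 : ℤ) else 0 := by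
    ext u v
    rw [← Matrix.transpose_transpose (D * P), ← Matrix.transpose_mul, Matrix.transpose_apply,
      hmul]
    simp only [Matrix.transpose_apply, hmul, hD, Matrix.of_apply]
    by_cases hu : u = r <;> by_cases hv : v = r
    · simp [hu, hv]
    · have := (hp v hv).2
      simp [hu, hv]
      omega
    · have := (hp u hu).2
      simp [hu, hv, G.dist_comm (v := r)]
      omega
    · obtain ⟨hu₁, hu₂⟩ := hp u hu
      obtain ⟨hv₁, hv₂⟩ := hp v hv
      by_cases huv : u = v
      · subst huv
        simp [hu, SimpleGraph.dist_eq_one_iff_adj.mpr hu₁,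
          SimpleGraph.dist_eq_one_iff_adj.mpr hu₁.symm]
      · simp only [hu, hv, huv, if_false]
        by_cases huv' : u = p v
        · have hvu' : v ≠ p u := by
            rintro rfl
            rw [← huv'] at hv₂
            omega
          have := hG.dist_sub_dist_eq hv₁ hu₁ (Ne.symm huv) hvu'
          simp only [G.dist_comm (u := v), G.dist_comm (u := p v)] at this
          linarith
        · linarith [hG.dist_sub_dist_eq hu₁ hv₁ huv huv']
  have hdet : D.det = (P.transpose * (D * P)).det := by
    rw [Matrix.det_mul, Matrix.det_mul, Matrix.det_transpose, hP, one_mul, mul_one]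
  have h2 := Matrix.two_mul_det_bordered r
  rw [← hM, ← hdet, hn] at h2
  obtain ⟨m, rfl⟩ := Nat.exists_eq_add_of_le' hn2
  have e₁ : m + 2 - 1 = m + 1 := rfl
  have e₂ : m + 2 - 2 = m := rfl
  rw [e₁, neg_pow, pow_succ 2] at h2
  rw [e₁, e₂]
  linarith
end

section
/- Let T be a finite tree and let S be a subset of its vertices of cardinality m ≥ 3 such that the induced subgraph of T on S is connected (hence a tree). Then det D[S] = (-1)^{m-1} · (m-1) · 2^{m-2}. -/
open scoped Classical

namespace SimpleGraph

variable {V : Type*} {G : SimpleGraph V}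

/-- In an acyclic graph, every path is a shortest walk. -/
theorem IsAcyclic.length_eq_dist (hG : G.IsAcyclic) {a b : V} {p : G.Walk a b} (hp : p.IsPath) :
    p.length = G.dist a b := by
  obtain ⟨q, hq, hlen⟩ := p.reachable.exists_path_of_dist
  have h : p = q := congrArg Subtype.val ((hG.subsingleton_path a b).elim ⟨p, hp⟩ ⟨q, hq⟩)
  rw [h, hlen]

/-- A connected induced subgraph of an acyclic graph is isometrically embedded. -/
theorem IsAcyclic.dist_induce (hG : G.IsAcyclic) {s : Set V} (hs : (G.induce s).Connected)
    (a b : s) : (G.induce s).dist a b = G.dist a b := by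
  obtain ⟨q, hq, hlen⟩ := (hs.preconnected a b).exists_path_of_dist
  have h := hG.length_eq_dist (hq.map (f := (Embedding.induce s).toHom)
    (Embedding.induce (G := G) s).injective)
  rw [Walk.length_map] at h
  exact hlen.symm.trans h

/-- The distance from a leaf to another vertex is one more than the distance from the unique
neighbor of the leaf. -/
theorem Connected.dist_eq_dist_add_one_of_forall_adj_eq (hG : G.Connected) {u v w : V}
    (huv : G.Adj v u) (hu : ∀ x, G.Adj v x → x = u) (hw : w ≠ v) :
    G.dist v w = G.dist u w + 1 := by
  obtain ⟨p, hp⟩ := hG.exists_walk_length_eq_dist v w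
  refine le_antisymm ?_ ?_
  · have h := hG.dist_triangle (u := v) (v := u) (w := w)
    rw [dist_eq_one_iff_adj.mpr huv] at h
    omega
  · cases p with
    | nil => exact absurd rfl hw
    | cons h p =>
      obtain rfl := hu _ h
      rw [← hp, Walk.length_cons]
      exact Nat.succ_le_succ (dist_le p)

end SimpleGraph

/-- If row and column `v` of `M` exceed row and column `u` by one off the diagonal and the diagonal
entries at `u` and `v` agree, then `v` can be eliminated from the determinant of `M`. -/
theorem Matrix.det_eq_neg_two_mul_det_compl_singleton {n : Type*} [Fintype n]
    (M : Matrix n n ℚ) {u v : n} (huv : u ≠ v) (hrow : ∀ w, w ≠ v → M v w = M u w + 1)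
    (hcol : ∀ w, w ≠ v → M w v = M w u + 1) (hdiag : M v v = M u u) :
    M.det = -2 * (Matrix.of fun a b : ({v}ᶜ : Set n) => M a b + 1 / 2).det := by
  let N : Matrix ({v}ᶜ : Set n) ({v}ᶜ : Set n) ℚ := Matrix.of fun a b => M a b + 1 / 2
  let u' : ({v}ᶜ : Set n) := ⟨u, huv⟩
  let R : Matrix ({v} : Set n) ({v}ᶜ : Set n) ℚ := Matrix.of fun _ b => if b = u' then 1 else 0
  let R' : Matrix ({v}ᶜ : Set n) ({v} : Set n) ℚ := Matrix.of fun a _ => if a = u' then 1 else 0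
  let J : Matrix ({v} : Set n) ({v}ᶜ : Set n) ℚ := Matrix.of fun _ _ => 1
  let L : Matrix ({v}ᶜ : Set n) ({v} : Set n) ℚ := Matrix.of fun _ _ => -1 / 2
  let D : Matrix ({v} : Set n) ({v} : Set n) ℚ := Matrix.of fun _ _ => -2
  have hblocks : M.submatrix (Equiv.Set.sumCompl {v}) (Equiv.Set.sumCompl {v}) =
      fromBlocks 1 R 0 1 * (fromBlocks 1 0 L 1 * fromBlocks D J 0 N) *
        fromBlocks 1 0 R' 1 := by
    simp only [fromBlocks_multiply]
    ext (⟨i, hi⟩ | i) (⟨j, hj⟩ | j)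
    · obtain rfl : i = v := hi
      obtain rfl : j = i := hj
      simp [Matrix.mul_apply, R, R', J, L, D, N, u', hdiag]
      ring
    · obtain rfl : i = v := hi
      simp [Matrix.mul_apply, R, J, L, N, u', hrow _ j.2]
      ring
    · obtain rfl : j = v := hj
      simp [Matrix.mul_apply, R', J, L, D, N, u', hcol _ i.2]
      ring
    · simp [Matrix.mul_apply, J, L, N]
      ring
  rw [← det_submatrix_equiv_self (Equiv.Set.sumCompl {v}) M, hblocks]
  simp [D, N, det_unique]

/-- The **Graham–Pollak determinant formula** for the distance matrix of a tree, with all entries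
shifted by a constant. -/
theorem SimpleGraph.IsTree.det_dist_add {V : Type*} [Fintype V] {G : SimpleGraph V}
    (hG : G.IsTree) (x : ℚ) :
    (Matrix.of fun i j => (G.dist i j : ℚ) + x).det =
      (-2) ^ (Fintype.card V - 1) * (x + ((Fintype.card V : ℚ) - 1) / 2) := by
  induction hn : Fintype.card V generalizing V x with
  | zero =>
    have := hG.connected.nonempty
    exact absurd hn Fintype.card_ne_zero
  | succ k ih =>
    obtain rfl | hk := Nat.eq_zero_or_pos k
    · obtain ⟨v, hv⟩ := Fintype.card_eq_one_iff.mp hn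
      let _ : Unique V := ⟨⟨v⟩, hv⟩
      simp [Matrix.det_unique]
    have : Nontrivial V := Fintype.one_lt_card_iff_nontrivial.mp (by omega)
    obtain ⟨v, hv⟩ := hG.exists_vert_degree_one_of_nontrivial
    obtain ⟨u, hvu, hu⟩ := SimpleGraph.degree_eq_one_iff_existsUnique_adj.mp hv
    have hH := hG.connected.induce_compl_singleton_of_degree_eq_one hv
    have hdist : ∀ w, w ≠ v → G.dist v w = G.dist u w + 1 := fun w hw =>
      hG.connected.dist_eq_dist_add_one_of_forall_adj_eq hvu hu hw
    have hcard : Fintype.card ({v}ᶜ : Set V) = k := by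
      rw [Fintype.card_compl_set, hn]; simp
    rw [Matrix.det_eq_neg_two_mul_det_compl_singleton _ hvu.ne'
      (fun w hw => by simp only [Matrix.of_apply, hdist w hw]; push_cast; ring)
      (fun w hw => by
        simp only [Matrix.of_apply, G.dist_comm (u := w), hdist w hw]; push_cast; ring)
      (by simp)]
    have h := ih ⟨hH, hG.isAcyclic.induce _⟩ (x + 1 / 2) hcard
    simp only [hG.isAcyclic.dist_induce hH, ← add_assoc] at h
    simp only [Matrix.of_apply]
    calc _ = -2 * ((-2) ^ (k - 1) * (x + 1 / 2 + ((k : ℚ) - 1) / 2)) := by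
          rw [← h]; congr!
      _ = _ := by
          rw [← mul_assoc, mul_pow_sub_one hk.ne', Nat.add_sub_cancel]
          push_cast
          ring

theorem principal_minor_of_induced_subtree
    {V : Type*} [Fintype V] (G : SimpleGraph V) (hG : G.IsTree)
    (S : Finset V) (m : ℕ) (hm : S.card = m) (hm3 : 3 ≤ m)
    (hconn : (G.induce (S : Set V)).Connected) :
    Matrix.det (Matrix.of fun i j : {x // x ∈ S} => (G.dist i.val j.val : ℤ)) =
      (-1) ^ (m - 1) * ((m : ℤ) - 1) * 2 ^ (m - 2) := by
  have h := SimpleGraph.IsTree.det_dist_add ⟨hconn, hG.isAcyclic.induce _⟩ 0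
  simp only [hG.isAcyclic.dist_induce hconn, add_zero] at h
  have hcard : Fintype.card (S : Set V) = m := by simpa using hm
  rw [hcard] at h
  apply Int.cast_injective (α := ℚ)
  rw [Int.cast_det]
  refine Eq.trans ?_ (h.trans ?_)
  · congr 1
  · obtain ⟨k, rfl⟩ := Nat.exists_eq_add_of_le hm3
    rw [show 3 + k - 1 = k + 2 by omega, show 3 + k - 2 = k + 1 by omega, neg_pow]
    push_cast
    ring
end

section
/- Let T be a finite tree, let D be its distance matrix, and let S be a subset of vertices of cardinality m ≥ 2. Then det D[S] = Σ_{(σ,f) ∈ K_S} sgn(σ), the sum of the signs of all S-catalysts for T, as integers. -/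
open scoped Classical

/-- `(σ, f)` is an `S`-catalyst for `G`: `σ` is a permutation of `S` and, for each
`i ∈ S`, `f i = (u, v)` is an oriented edge of `G` lying on the path from `i` to
`σ i`, oriented along it. -/
def IsCatalyst {V : Type*} [Fintype V] (G : SimpleGraph V) (S : Finset V)
    (σ : Equiv.Perm {x // x ∈ S}) (f : {x // x ∈ S} → V × V) : Prop :=
  ∀ i : {x // x ∈ S}, G.Adj (f i).1 (f i).2 ∧
    G.dist i.val (f i).1 + 1 + G.dist (f i).2 (σ i).val = G.dist i.val (σ i).val

/-- In a tree, there are exactly `d(a, b)` arcs lying on the path from `a` to `b` and oriented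
along it. -/
theorem SimpleGraph.IsTree.card_arcs_between {V : Type*} [Fintype V] {G : SimpleGraph V}
    (hG : G.IsTree) (a b : V) :
    (Finset.univ.filter fun e : V × V =>
      G.Adj e.1 e.2 ∧ G.dist a e.1 + 1 + G.dist e.2 b = G.dist a b).card = G.dist a b := by
  obtain ⟨p, hp⟩ := hG.connected.exists_walk_length_eq_dist a b
  have hpath : p.IsPath := p.isPath_of_length_eq_dist hp
  conv_rhs => rw [← Finset.card_range (G.dist a b)]
  symm
  refine Finset.card_nbij (fun k => (p.getVert k, p.getVert (k + 1))) ?_ ?_ ?_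
  · intro k hk
    have hk' : k < G.dist a b := by simpa using hk
    have hadj : G.Adj (p.getVert k) (p.getVert (k + 1)) := p.adj_getVert_succ (by omega)
    have h₁ := SimpleGraph.dist_le (p.take k)
    have h₂ := SimpleGraph.dist_le (p.drop (k + 1))
    have h₃ := hG.connected.dist_triangle (u := a) (v := p.getVert k) (w := b)
    have h₄ := hG.connected.dist_triangle (u := p.getVert k) (v := p.getVert (k + 1)) (w := b)
    rw [SimpleGraph.dist_eq_one_iff_adj.mpr hadj] at h₄
    rw [SimpleGraph.Walk.take_length] at h₁
    rw [SimpleGraph.Walk.drop_length] at h₂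
    simp only [Finset.coe_filter, Finset.mem_univ, true_and, Set.mem_ofPred_eq]
    exact ⟨hadj, by omega⟩
  · intro k hk l hl hkl
    simp only [Finset.coe_range, Set.mem_Iio] at hk hl
    exact hpath.getVert_injOn (by simp; omega) (by simp; omega) (Prod.ext_iff.mp hkl).1
  · rintro ⟨u, v⟩ he
    simp only [Finset.coe_filter, Finset.mem_univ, true_and, Set.mem_ofPred_eq] at he
    obtain ⟨hadj, hd⟩ := he
    obtain ⟨q, hq⟩ := hG.connected.exists_walk_length_eq_dist a u
    obtain ⟨r, hr⟩ := hG.connected.exists_walk_length_eq_dist v b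
    have hlen : (q.append (.cons hadj r)).length = G.dist a b := by
      rw [SimpleGraph.Walk.length_append, SimpleGraph.Walk.length_cons]
      omega
    obtain rfl : p = q.append (.cons hadj r) :=
      (hG.existsUnique_path a b).unique hpath (SimpleGraph.Walk.isPath_of_length_eq_dist _ hlen)
    refine ⟨G.dist a u, by simp; omega, ?_⟩
    simp [SimpleGraph.Walk.getVert_append, hq]

/-- The number of `S`-catalysts with a given underlying permutation is the corresponding product
of distances. -/
theorem card_isCatalyst {V : Type*} [Fintype V] {G : SimpleGraph V} (hG : G.IsTree)
    (S : Finset V) (σ : Equiv.Perm {x // x ∈ S}) :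
    (Finset.univ.filter (IsCatalyst G S σ)).card = ∏ i, G.dist i.val (σ i).val := by
  have h : Finset.univ.filter (IsCatalyst G S σ) =
      Fintype.piFinset fun i : {x // x ∈ S} => Finset.univ.filter fun e : V × V =>
        G.Adj e.1 e.2 ∧ G.dist i.val e.1 + 1 + G.dist e.2 (σ i).val =
          G.dist i.val (σ i).val := by
    ext f
    simp [IsCatalyst, Fintype.mem_piFinset]
  rw [h, Fintype.card_piFinset]
  exact Finset.prod_congr rfl fun i _ => hG.card_arcs_between _ _

theorem det_minor_eq_sum_over_catalysts
    {V : Type*} [Fintype V] (G : SimpleGraph V) (hG : G.IsTree)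
    (S : Finset V) (m : ℕ) (hm : S.card = m) (hm2 : 2 ≤ m) :
    Matrix.det (Matrix.of fun i j : {x // x ∈ S} => (G.dist i.val j.val : ℤ)) =
      ∑ κ ∈ Finset.univ.filter
          (fun κ : Equiv.Perm {x // x ∈ S} × ({x // x ∈ S} → V × V) =>
            IsCatalyst G S κ.1 κ.2),
        (Equiv.Perm.sign κ.1 : ℤ) := by
  rw [Matrix.det_apply', Finset.sum_filter, Fintype.sum_prod_type]
  refine Finset.sum_congr rfl fun σ _ => ?_
  rw [← Finset.sum_filter]
  dsimp only
  rw [Finset.sum_const, card_isCatalyst hG S σ, nsmul_eq_mul, mul_comm]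
  simp [SimpleGraph.dist_comm]
end

section
/- Let T be a finite tree and let S be a subset of its vertices of cardinality m ≥ 2. Then every m-arrowflow A on T is zero-sum for S, unital for S, or composite for S. -/
open scoped Classical

/-- An `m`-arrowflow on `G`: a multiset of `m` ordered pairs, each supported on an
edge of `G`. -/
def IsArrowflow {V : Type*} (G : SimpleGraph V) (m : ℕ) (A : Multiset (V × V)) : Prop :=
  Multiset.card A = m ∧ ∀ p ∈ A, G.Adj p.1 p.2

/-- The underlying simple graph of an arrowflow: `u ~ v` iff `(u,v)` or `(v,u)` is an
arc of `A`. -/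
def arrowSG {V : Type*} (A : Multiset (V × V)) : SimpleGraph V :=
  SimpleGraph.fromRel (fun u v => (u, v) ∈ A)

/-- The missing forest of an arrowflow `A` on `G`: the spanning subgraph of `G` whose
edges are the edges of `G` not underlying any arc of `A`. -/
def missingForest {V : Type*} (G : SimpleGraph V) (A : Multiset (V × V)) : SimpleGraph V :=
  G \ arrowSG A

/-- `A` has parallel arrows: some ordered pair occurs with multiplicity at least 2. -/
def HasParallelArrows {V : Type*} (A : Multiset (V × V)) : Prop :=
  ∃ p : V × V, 2 ≤ A.count p

/-- `A` has a missing path for `S`: two distinct vertices of `S` lie in the same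
connected component of the missing forest. -/
def HasMissingPath {V : Type*} (G : SimpleGraph V) (S : Finset V) (A : Multiset (V × V)) : Prop :=
  ∃ i ∈ S, ∃ j ∈ S, i ≠ j ∧ (missingForest G A).Reachable i j

/-- `A` is zero-sum for `S`. -/
def IsZeroSum {V : Type*} (G : SimpleGraph V) (S : Finset V) (A : Multiset (V × V)) : Prop :=
  HasParallelArrows A ∨ HasMissingPath G S A

/-- `A` is unital for `S`: no parallel arrows, and the missing forest is `S`-rooted. -/
def IsUnital {V : Type*} (G : SimpleGraph V) (S : Finset V) (A : Multiset (V × V)) : Prop :=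
  ¬ HasParallelArrows A ∧ IsSRootedForest G (missingForest G A) S

/-- `A` is composite for `S`: no parallel arrows, and the missing forest is
`(S,*)`-rooted. -/
def IsComposite {V : Type*} (G : SimpleGraph V) (S : Finset V) (A : Multiset (V × V)) : Prop :=
  ¬ HasParallelArrows A ∧ IsSStarRootedForest G (missingForest G A) S

/-- If every edge of `H` outside `K` joins `u` and `v`, then `H`-reachability is
`K`-reachability up to one passage through `{u, v}`. -/
lemma SimpleGraph.Reachable.of_single_extra_edge {V : Type*} {H K : SimpleGraph V} {u v : V}
    (h : ∀ a b, H.Adj a b → K.Adj a b ∨ (a = u ∧ b = v) ∨ (a = v ∧ b = u))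
    {x y : V} (hxy : H.Reachable x y) :
    K.Reachable x y ∨ (K.Reachable x u ∧ K.Reachable v y) ∨
      (K.Reachable x v ∧ K.Reachable u y) := by
  obtain ⟨p⟩ := hxy
  induction p with
  | nil => exact Or.inl (Reachable.refl _)
  | @cons a b c hab p ih =>
    rcases h a b hab with hK | ⟨rfl, rfl⟩ | ⟨rfl, rfl⟩
    · have hr := hK.reachable
      exact ih.imp hr.trans (Or.imp (And.imp_left hr.trans) (And.imp_left hr.trans))
    · rcases ih with ih | ih | ih
      · exact Or.inr (Or.inl ⟨Reachable.refl _, ih⟩)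
      · exact Or.inr (Or.inl ⟨Reachable.refl _, ih.2⟩)
      · exact Or.inl ih.2
    · rcases ih with ih | ih | ih
      · exact Or.inr (Or.inr ⟨Reachable.refl _, ih⟩)
      · exact Or.inl ih.2
      · exact Or.inr (Or.inr ⟨Reachable.refl _, ih.2⟩)

/-- If every edge of `H` outside `K` joins `u` and `v`, then a set of vertices in distinct
components of `K` lies in distinct components of `H` after removing at most one vertex. -/
lemma SimpleGraph.exists_subset_separated_of_single_extra_edge {V : Type*}
    {H K : SimpleGraph V} {u v : V}
    (h : ∀ a b, H.Adj a b → K.Adj a b ∨ (a = u ∧ b = v) ∨ (a = v ∧ b = u))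
    {P : Finset V} (hP : ∀ x ∈ P, ∀ y ∈ P, K.Reachable x y → x = y) :
    ∃ Q ⊆ P, P.card ≤ Q.card + 1 ∧ ∀ x ∈ Q, ∀ y ∈ Q, H.Reachable x y → x = y := by
  refine ⟨P.filter (fun x => ¬ K.Reachable x u), Finset.filter_subset _ _, ?_, ?_⟩
  · have hone : (P.filter (fun x => K.Reachable x u)).card ≤ 1 := by
      refine Finset.card_le_one.2 fun a ha b hb => ?_
      rw [Finset.mem_filter] at ha hb
      exact hP a ha.1 b hb.1 (ha.2.trans hb.2.symm)
    have hsum := P.card_filter_add_card_filter_not (fun x => K.Reachable x u)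
    omega
  · intro x hx y hy hxy
    rw [Finset.mem_filter] at hx hy
    rcases hxy.of_single_extra_edge h with h' | h' | h'
    · exact hP x hx.1 y hy.1 h'
    · exact absurd h'.1 hx.2
    · exact absurd h'.2.symm hy.2

lemma missingForest_adj {V : Type*} {G : SimpleGraph V} {A : Multiset (V × V)} {a b : V} :
    (missingForest G A).Adj a b ↔ G.Adj a b ∧ (a, b) ∉ A ∧ (b, a) ∉ A := by
  simp only [missingForest, arrowSG, SimpleGraph.sdiff_adj, SimpleGraph.fromRel_adj]
  have := @SimpleGraph.Adj.ne V G a b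
  tauto

/-- The missing forest of `A` on a connected graph has at most `|A| + 1` components. -/
lemma card_le_of_missingForest_separated {V : Type*} {G : SimpleGraph V} (hG : G.Preconnected)
    (A : Multiset (V × V)) (P : Finset V)
    (hP : ∀ x ∈ P, ∀ y ∈ P, (missingForest G A).Reachable x y → x = y) :
    P.card ≤ Multiset.card A + 1 := by
  induction A using Multiset.induction_on generalizing P with
  | empty =>
    refine Finset.card_le_one.2 fun a ha b hb => hP a ha b hb ((hG a b).mono ?_)
    exact fun x y hxy => missingForest_adj.2 (by simpa using hxy)
  | cons e A ih =>
    have h : ∀ a b, (missingForest G A).Adj a b → (missingForest G (e ::ₘ A)).Adj a b ∨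
        (a = e.1 ∧ b = e.2) ∨ (a = e.2 ∧ b = e.1) := by
      intro a b
      simp only [missingForest_adj, Multiset.mem_cons, Prod.ext_iff]
      tauto
    obtain ⟨Q, -, hcard, hQ⟩ := SimpleGraph.exists_subset_separated_of_single_extra_edge h hP
    have := ih Q hQ
    rw [Multiset.card_cons]
    omega

theorem arrowflow_trichotomy
    {V : Type*} [Fintype V] (G : SimpleGraph V) (hG : G.IsTree)
    (S : Finset V) (m : ℕ) (hm : S.card = m) (hm2 : 2 ≤ m)
    (A : Multiset (V × V)) (hA : IsArrowflow G m A) :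
    IsZeroSum G S A ∨ IsUnital G S A ∨ IsComposite G S A := by
  rw [or_iff_not_imp_left]
  intro hz
  obtain ⟨hpar, hpath⟩ := not_or.1 hz
  have hle : missingForest G A ≤ G := sdiff_le
  have hacyc : (missingForest G A).IsAcyclic := hG.isAcyclic.anti hle
  have hsep : ∀ s ∈ S, ∀ t ∈ S, (missingForest G A).Reachable s t → s = t := by
    intro s hs t ht hst
    by_contra hne
    exact hpath ⟨s, hs, t, ht, hne, hst⟩
  rcases (floatSet (missingForest G A) S).eq_empty_or_nonempty with hfl | hfl
  · refine Or.inl ⟨hpar, hle, hacyc, hsep, fun v => ?_⟩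
    have hv : v ∉ floatSet (missingForest G A) S := hfl ▸ Set.notMem_empty v
    simpa [floatSet] using hv
  · refine Or.inr ⟨hpar, hle, hacyc, hsep, hfl, fun v hv w hw => ?_⟩
    by_contra hvw
    have hwS : w ∉ S := fun hmem => hw w hmem (SimpleGraph.Reachable.refl _)
    have hvS : v ∉ insert w S := by
      rw [Finset.mem_insert, not_or]
      exact ⟨fun h => hvw (h ▸ SimpleGraph.Reachable.refl _),
        fun hmem => hv v hmem (SimpleGraph.Reachable.refl _)⟩
    have hcard := card_le_of_missingForest_separated hG.connected.preconnected A
      (insert v (insert w S)) (by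
        intro x hx y hy hxy
        rw [Finset.mem_insert, Finset.mem_insert] at hx hy
        rcases hx with rfl | rfl | hx <;> rcases hy with rfl | rfl | hy
        · rfl
        · exact absurd hxy hvw
        · exact absurd hxy.symm (hv y hy)
        · exact absurd hxy.symm hvw
        · rfl
        · exact absurd hxy.symm (hw y hy)
        · exact absurd hxy (hv x hx)
        · exact absurd hxy (hw x hx)
        · exact hsep x hx y hy hxy)
    rw [Finset.card_insert_of_notMem hvS, Finset.card_insert_of_notMem hwS, hA.1] at hcard
    omega
end

section
/- Let T be a finite tree, let S be a subset of its vertices of cardinality m ≥ 2, and let A be an m-arrowflow on T that is zero-sum for S. Then Σ_{(σ,f) ∈ C_S(A)} sgn(σ) = 0. -/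
open scoped Classical

/-- The catalyst `(σ, f)` induces the arrowflow `A`: the multiset of values of `f`
equals `A`. -/
def Induces {V : Type*} (S : Finset V) (f : {x // x ∈ S} → V × V)
    (A : Multiset (V × V)) : Prop :=
  Multiset.map f (Finset.univ : Finset {x // x ∈ S}).val = A

/-- The signed enumeration of the `S`-catalysts for `G` inducing the arrowflow `A`. -/
noncomputable def classSum {V : Type*} [Fintype V] (G : SimpleGraph V) (S : Finset V)
    (A : Multiset (V × V)) : ℤ :=
  ∑ κ ∈ Finset.univ.filter
      (fun κ : Equiv.Perm {x // x ∈ S} × ({x // x ∈ S} → V × V) =>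
        IsCatalyst G S κ.1 κ.2 ∧ Induces S κ.2 A),
    (Equiv.Perm.sign κ.1 : ℤ)

/-- A walk leaving the component of `u` in `G` minus the edge `uv` has to traverse that edge. -/
lemma SimpleGraph.Walk.dist_add_one_add_dist_le_length {V : Type*} {G : SimpleGraph V}
    (hG : G.Connected) {u v : V} (huv : ¬ (G.deleteEdges {s(u, v)}).Reachable v u) {x y : V}
    (p : G.Walk x y) (hx : (G.deleteEdges {s(u, v)}).Reachable x u)
    (hy : ¬ (G.deleteEdges {s(u, v)}).Reachable y u) :
    G.dist x u + 1 + G.dist v y ≤ p.length := by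
  induction p with
  | nil => exact absurd hx hy
  | @cons x z y h p ih =>
    rw [SimpleGraph.Walk.length_cons]
    by_cases hz : (G.deleteEdges {s(u, v)}).Reachable z u
    · have hp := ih hz hy
      have htri : G.dist x u ≤ G.dist x z + G.dist z u := hG.dist_triangle
      rw [SimpleGraph.dist_eq_one_iff_adj.2 h] at htri
      omega
    · have hxz : s(x, z) = s(u, v) := by
        by_contra hne
        have hadj : (G.deleteEdges {s(u, v)}).Adj z x :=
          (SimpleGraph.deleteEdges_adj.2 ⟨h, by simpa using hne⟩).symm
        exact hz (hadj.reachable.trans hx)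
      rcases Sym2.eq_iff.1 hxz with ⟨rfl, rfl⟩ | ⟨rfl, rfl⟩
      · have hp := SimpleGraph.dist_le p
        simp only [SimpleGraph.dist_self]
        omega
      · exact absurd hx huv

/-- In a tree, an arc lies on the path from `x` to `y` iff deleting it leaves `x`, but not `y`,
in the component of its tail. -/
lemma SimpleGraph.IsTree.dist_add_one_add_dist_eq_iff {V : Type*} {G : SimpleGraph V}
    (hG : G.IsTree) {u v : V} (huv : G.Adj u v) (x y : V) :
    G.dist x u + 1 + G.dist v y = G.dist x y ↔
      (G.deleteEdges {s(u, v)}).Reachable x u ∧ ¬ (G.deleteEdges {s(u, v)}).Reachable y u := by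
  have hconn := hG.connected
  have hbridge : ¬ (G.deleteEdges {s(u, v)}).Reachable v u := fun h =>
    SimpleGraph.isBridge_iff.1
      (SimpleGraph.isAcyclic_iff_forall_adj_isBridge.1 hG.isAcyclic huv) h.symm
  have hle {a b : V} (ha : (G.deleteEdges {s(u, v)}).Reachable a u)
      (hb : ¬ (G.deleteEdges {s(u, v)}).Reachable b u) :
      G.dist a u + 1 + G.dist v b ≤ G.dist a b := by
    obtain ⟨p, hp⟩ := hconn.exists_walk_length_eq_dist a b
    exact hp ▸ p.dist_add_one_add_dist_le_length hconn hbridge ha hb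
  constructor
  · intro h
    have hx : (G.deleteEdges {s(u, v)}).Reachable x u := by
      by_contra hx
      have h1 := hle (SimpleGraph.Reachable.refl u) hx
      have h2 : G.dist x y ≤ G.dist x v + G.dist v y := hconn.dist_triangle
      rw [SimpleGraph.dist_self, G.dist_comm (u := v), G.dist_comm (u := u)] at h1
      omega
    refine ⟨hx, fun hy => ?_⟩
    have h1 := hle hy hbridge
    have h2 : G.dist x y ≤ G.dist x u + G.dist u y := hconn.dist_triangle
    rw [SimpleGraph.dist_self, G.dist_comm (u := y), G.dist_comm (u := y)] at h1
    omega
  · rintro ⟨hx, hy⟩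
    refine le_antisymm (hle hx hy) ?_
    have h1 : G.dist x y ≤ G.dist x u + G.dist u y := hconn.dist_triangle
    have h2 : G.dist u y ≤ G.dist u v + G.dist v y := hconn.dist_triangle
    rw [SimpleGraph.dist_eq_one_iff_adj.2 huv] at h2
    omega

lemma isCatalyst_iff {V : Type*} [Fintype V] {G : SimpleGraph V} (hG : G.IsTree) {S : Finset V}
    {f : {x // x ∈ S} → V × V} (hf : ∀ i, G.Adj (f i).1 (f i).2)
    (σ : Equiv.Perm {x // x ∈ S}) :
    IsCatalyst G S σ f ↔
      (∀ i, (G.deleteEdges {s((f i).1, (f i).2)}).Reachable i.val (f i).1) ∧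
      ∀ i, ¬ (G.deleteEdges {s((f i).1, (f i).2)}).Reachable (σ i).val (f i).1 := by
  rw [← forall_and]
  refine forall_congr' fun i => ?_
  rw [hG.dist_add_one_add_dist_eq_iff (hf i)]
  exact and_iff_right (hf i)

/-- A signed count of permutations is zero if the condition is invariant under a sign-reversing
bijection. -/
lemma sum_sign_eq_zero_of_equiv {α : Type*} [Fintype α] [DecidableEq α]
    (P : Equiv.Perm α → Prop) (e : Equiv.Perm α ≃ Equiv.Perm α)
    (hsign : ∀ σ, Equiv.Perm.sign (e σ) = -Equiv.Perm.sign σ) (hP : ∀ σ, P (e σ) ↔ P σ) :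
    ∑ σ, (if P σ then (Equiv.Perm.sign σ : ℤ) else 0) = 0 := by
  have h : ∑ σ, (if P σ then (Equiv.Perm.sign σ : ℤ) else 0) =
      -∑ σ, (if P σ then (Equiv.Perm.sign σ : ℤ) else 0) := by
    rw [← Finset.sum_neg_distrib, ← Equiv.sum_comp e]
    refine Finset.sum_congr rfl fun σ _ => ?_
    by_cases hσ : P σ <;> simp [hP, hσ, hsign]
  omega

lemma missingForest_le_deleteEdges {V : Type*} (G : SimpleGraph V) {A : Multiset (V × V)}
    {p : V × V} (hp : p ∈ A) : missingForest G A ≤ G.deleteEdges {s(p.1, p.2)} := by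
  intro a b hab
  obtain ⟨hG, hA⟩ := hab
  refine SimpleGraph.deleteEdges_adj.2 ⟨hG, fun h => hA ?_⟩
  refine (SimpleGraph.fromRel_adj _ _ _).2 ⟨hG.ne, ?_⟩
  rcases Sym2.eq_iff.1 h with ⟨rfl, rfl⟩ | ⟨rfl, rfl⟩
  · exact Or.inl hp
  · exact Or.inr hp

lemma HasParallelArrows.exists_ne_eq {V : Type*} {S : Finset V} {A : Multiset (V × V)}
    (hA : HasParallelArrows A) {f : {x // x ∈ S} → V × V} (hf : Induces S f A) :
    ∃ i j, i ≠ j ∧ f i = f j := by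
  obtain ⟨p, hp⟩ := hA
  by_contra! hne
  have hinj : Function.Injective f := fun i j hij => by_contra fun h => hne i j h hij
  have hnodup : A.Nodup := hf ▸ Finset.univ.nodup.map hinj
  have := Multiset.nodup_iff_count_le_one.1 hnodup p
  omega

theorem zero_sum_arrowflow_class_sum
    {V : Type*} [Fintype V] (G : SimpleGraph V) (hG : G.IsTree)
    (S : Finset V) (m : ℕ) (hm : S.card = m) (hm2 : 2 ≤ m)
    (A : Multiset (V × V)) (hA : IsArrowflow G m A) (hzs : IsZeroSum G S A) :
    classSum G S A = 0 := by
  rw [classSum, Finset.sum_filter, Fintype.sum_prod_type_right]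
  refine Finset.sum_eq_zero fun f _ => ?_
  by_cases hf : Induces S f A
  swap
  · simp [hf]
  have hmem (i) : f i ∈ A := hf ▸ Multiset.mem_map_of_mem f (Finset.mem_univ_val i)
  have hiff := isCatalyst_iff hG fun i => hA.2 _ (hmem i)
  simp only [hf, and_true]
  rcases hzs with hpar | ⟨i, hi, j, hj, hij, hreach⟩
  · obtain ⟨i, j, hij, hfij⟩ := hpar.exists_ne_eq hf
    have hswap (k) : f (Equiv.swap i j k) = f k := by
      rw [Equiv.swap_apply_def]
      split_ifs <;> simp_all
    refine sum_sign_eq_zero_of_equiv _ (Equiv.mulRight (Equiv.swap i j))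
      (fun σ => by simp [Equiv.Perm.sign_swap hij]) fun σ => ?_
    rw [hiff, hiff]
    refine and_congr_right fun _ => ?_
    rw [← (Equiv.swap i j).forall_congr_right]
    simp [hswap]
  · refine sum_sign_eq_zero_of_equiv _ (Equiv.mulLeft (Equiv.swap ⟨i, hi⟩ ⟨j, hj⟩))
      (fun σ => by simp [Equiv.Perm.sign_swap', hij])
      fun σ => ?_
    rw [hiff, hiff]
    refine and_congr_right fun _ => forall_congr' fun k => not_congr ?_
    have hk := hreach.mono (missingForest_le_deleteEdges G (hmem k))
    simp only [Equiv.coe_mulLeft, Equiv.Perm.mul_apply, Equiv.swap_apply_def]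
    split_ifs with h1 h2
    · rw [h1]
      exact ⟨hk.trans, hk.symm.trans⟩
    · rw [h2]
      exact ⟨hk.symm.trans, hk.trans⟩
    · rfl
end

section
/- Let T be a finite tree, let S be a subset of its vertices of cardinality m ≥ 2, and let A be an m-arrowflow on T that is unital for S. Then Σ_{(σ,f) ∈ C_S(A)} sgn(σ) = (-1)^{m-1}. -/
open scoped Classical

namespace SimpleGraph

variable {V : Type*} {G H : SimpleGraph V}

/-- In a tree, the path from `i` to `j` runs through the arc `(u, v)` as soon as `i` is on
the side of `u` and `j` is on the side of `v`. -/
lemma IsTree.dist_eq_of_lt_of_lt (hG : G.IsTree) {u v i j : V} (h : G.Adj u v)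
    (hi : G.dist i u < G.dist i v) (hj : G.dist j v < G.dist j u) :
    G.dist i u + 1 + G.dist v j = G.dist i j := by
  obtain ⟨p, hp, hpl⟩ := hG.connected.exists_path_of_dist i u
  obtain ⟨q, hq, hql⟩ := hG.connected.exists_path_of_dist v j
  have hpath : (p.append (Walk.cons h q)).IsPath := by
    rw [Walk.isPath_def, Walk.support_append, Walk.support_cons, List.tail_cons]
    refine List.nodup_append.2 ⟨hp.support_nodup, hq.support_nodup, ?_⟩
    rintro a ha b hb rfl
    have h1 := dist_le (p.takeUntil a ha)
    have h2 := dist_le (p.dropUntil a ha)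
    have h3 := dist_le (q.takeUntil a hb)
    have h4 := dist_le (q.dropUntil a hb)
    have h5 := congrArg Walk.length (p.take_spec ha)
    have h6 := congrArg Walk.length (q.take_spec hb)
    rw [Walk.length_append] at h5 h6
    have h7 := hG.connected.dist_triangle (u := i) (v := a) (w := v)
    have h8 := hG.connected.dist_triangle (u := j) (v := a) (w := u)
    simp only [G.dist_comm (u := j), G.dist_comm (u := a) (v := v)] at *
    omega
  obtain ⟨r, hr, hrl⟩ := hG.connected.exists_path_of_dist i j
  have := congrArg Walk.length ((hG.existsUnique_path i j).unique hpath hr)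
  rw [Walk.length_append, Walk.length_cons] at this
  omega

lemma IsTree.dist_add_one_add_dist_eq_iff_s7 (hG : G.IsTree) {u v i j : V} (h : G.Adj u v) :
    G.dist i u + 1 + G.dist v j = G.dist i j ↔
      G.dist i u < G.dist i v ∧ G.dist j v < G.dist j u := by
  refine ⟨fun he ↦ ?_, fun hd ↦ hG.dist_eq_of_lt_of_lt h hd.1 hd.2⟩
  have h1 := hG.connected.dist_triangle (u := i) (v := v) (w := j)
  have h2 := hG.connected.dist_triangle (u := i) (v := u) (w := j)
  rw [G.dist_comm (u := j), G.dist_comm (u := j)]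
  omega

lemma IsTree.lt_of_adj_of_lt (hG : G.IsTree) {u v w x : V} (h : G.Adj u v) (hwx : G.Adj w x)
    (hne : ¬(w = u ∧ x = v)) (hw : G.dist w u < G.dist w v) : G.dist x u < G.dist x v := by
  by_contra hx
  have hx' : G.dist x v < G.dist x u :=
    lt_of_le_of_ne (not_lt.1 hx) (hG.dist_ne_of_adj x h.symm)
  have h1 := hG.dist_eq_of_lt_of_lt h hw hx'
  rw [dist_eq_one_iff_adj.2 hwx] at h1
  exact hne ⟨hG.connected.dist_eq_zero_iff.1 (by omega),
    (hG.connected.dist_eq_zero_iff.1 (by omega)).symm⟩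

lemma IsTree.lt_of_reachable_of_lt (hG : G.IsTree) (hHG : H ≤ G) {u v w x : V}
    (h : G.Adj u v) (hn : ¬H.Adj u v) (hwx : H.Reachable w x)
    (hw : G.dist w u < G.dist w v) : G.dist x u < G.dist x v := by
  obtain ⟨p⟩ := hwx
  induction p with
  | nil => exact hw
  | cons hadj _ ih =>
    refine ih (hG.lt_of_adj_of_lt h (hHG hadj) ?_ hw)
    rintro ⟨rfl, rfl⟩
    exact hn hadj

lemma IsTree.lt_of_reachable (hG : G.IsTree) (hHG : H ≤ G) {u v t : V}
    (h : G.Adj u v) (hn : ¬H.Adj u v) (ht : H.Reachable u t) : G.dist t u < G.dist t v := by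
  refine hG.lt_of_reachable_of_lt hHG h hn ht ?_
  rw [dist_self]
  exact hG.connected.pos_dist_of_ne h.ne

/-- There is at most one edge leaving a connected component of a subgraph of a tree in the
direction of a given vertex. -/
lemma IsTree.eq_and_eq_of_reachable_of_lt (hG : G.IsTree) (hHG : H ≤ G) {t w x w' x' : V}
    (h : G.Adj w x) (hn : ¬H.Adj w x) (h' : G.Adj w' x') (hn' : ¬H.Adj w' x')
    (hr : H.Reachable w w') (ht : G.dist t x < G.dist t w) (ht' : G.dist t x' < G.dist t w') :
    w = w' ∧ x = x' := by
  have h1 := hG.dist_eq_of_lt_of_lt h (hG.lt_of_reachable hHG h hn hr) ht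
  have h2 := hG.dist_eq_of_lt_of_lt h' (hG.lt_of_reachable hHG h' hn' hr.symm) ht'
  have h3 : w = w' := by
    refine hG.connected.dist_eq_zero_iff.1 ?_
    simp only [G.dist_comm (v := t)] at h1 h2
    rw [G.dist_comm (u := w')] at h1
    have h4 := hG.connected.dist_triangle (u := t) (v := x) (w := w)
    have h5 := hG.connected.dist_triangle (u := t) (v := x') (w := w')
    rw [dist_eq_one_iff_adj.2 h.symm] at h4
    rw [dist_eq_one_iff_adj.2 h'.symm] at h5
    omega
  subst h3
  refine ⟨rfl, ?_⟩
  by_contra hne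
  have hw : G.dist w w < G.dist w x := by
    rw [dist_self]
    exact hG.connected.pos_dist_of_ne h.ne
  have h4 := hG.dist_eq_of_lt_of_lt h
    (hG.lt_of_adj_of_lt h h' (fun hh ↦ hne hh.2.symm) hw) ht
  rw [dist_eq_one_iff_adj.2 h'.symm] at h4
  have h5 := hG.connected.dist_triangle (u := t) (v := x) (w := w)
  rw [dist_eq_one_iff_adj.2 h.symm] at h5
  rw [G.dist_comm (v := t), G.dist_comm (v := t)] at h4
  omega

lemma Connected.exists_adj_dist_lt (hG : G.Connected) {t w : V} (h : w ≠ t) :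
    ∃ x, G.Adj w x ∧ G.dist t x < G.dist t w := by
  obtain ⟨p, hp⟩ := hG.exists_walk_length_eq_dist w t
  cases p with
  | nil => exact absurd rfl h
  | cons hadj q =>
    refine ⟨_, hadj, ?_⟩
    have := dist_le q
    rw [Walk.length_cons] at hp
    rw [G.dist_comm, G.dist_comm (u := t)]
    omega

lemma Connected.exists_adj_leaving_reachable (hG : G.Connected) {s t : V}
    (hst : ¬H.Reachable s t) :
    ∃ w x, H.Reachable s w ∧ ¬H.Reachable s x ∧ G.Adj w x ∧ G.dist t x < G.dist t w := by
  suffices ∀ n w, G.dist t w = n → H.Reachable s w → ∃ w x, H.Reachable s w ∧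
      ¬H.Reachable s x ∧ G.Adj w x ∧ G.dist t x < G.dist t w from
    this _ s rfl (Reachable.refl s)
  intro n
  induction n using Nat.strong_induction_on with
  | _ n ih =>
    intro w hn hw
    obtain ⟨x, hx, hlt⟩ := hG.exists_adj_dist_lt (t := t) (w := w)
      (by rintro rfl; exact hst hw)
    by_cases hsx : H.Reachable s x
    · exact ih _ (hn ▸ hlt) x rfl hsx
    · exact ⟨w, x, hw, hsx, hx, hlt⟩

/-- Among the edges leaving the component of `s` in a subgraph of a tree, the number of those
pointing towards `t` is `0` or `1` according to whether `t` lies in that component. -/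
lemma IsTree.sum_leaving_eq [Fintype V] (hG : G.IsTree) (hHG : H ≤ G) (s t : V) :
    ∑ p : V × V with H.Reachable s p.1 ∧ ¬H.Reachable s p.2 ∧ G.Adj p.1 p.2,
      (if G.dist t p.2 < G.dist t p.1 then 1 else 0 : ℤ) =
        if H.Reachable s t then 0 else 1 := by
  have hn {w x : V} (hw : H.Reachable s w) (hx : ¬H.Reachable s x) : ¬H.Adj w x :=
    fun h ↦ hx (hw.trans h.reachable)
  split_ifs with hst
  · refine Finset.sum_eq_zero fun p hp ↦ if_neg ?_
    obtain ⟨-, h1, h2, h3⟩ := Finset.mem_filter.1 hp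
    exact (hG.lt_of_reachable hHG h3 (hn h1 h2) (h1.symm.trans hst)).not_gt
  · obtain ⟨w, x, hw, hx, hwx, hlt⟩ := hG.connected.exists_adj_leaving_reachable hst
    rw [Finset.sum_eq_single (w, x), if_pos hlt]
    · intro p hp hne
      obtain ⟨-, h1, h2, h3⟩ := Finset.mem_filter.1 hp
      refine if_neg fun hlt' ↦ hne ?_
      obtain ⟨h4, h5⟩ := hG.eq_and_eq_of_reachable_of_lt hHG h3 (hn h1 h2) hwx (hn hw hx)
        (h1.symm.trans hw) hlt' hlt
      exact Prod.ext h4 h5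
    · exact fun h ↦ absurd (Finset.mem_filter.2 ⟨Finset.mem_univ _, hw, hx, hwx⟩) h

end SimpleGraph

namespace Matrix

variable {ι : Type*} [Fintype ι] [DecidableEq ι]

lemma sum_perm_sign_mul_prod_eq_det_mul_det (X Y : Matrix ι ι ℤ) :
    ∑ σ : Equiv.Perm ι, ∑ π : Equiv.Perm ι,
      (Equiv.Perm.sign σ : ℤ) * ∏ i, X i (π i) * Y (π i) (σ i) = X.det * Y.det := by
  have hY (π : Equiv.Perm ι) : ∑ σ : Equiv.Perm ι,
      (Equiv.Perm.sign σ : ℤ) * ∏ i, Y (π i) (σ i) = (Equiv.Perm.sign π : ℤ) * Y.det := by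
    have h := det_permute π Y
    rw [Int.cast_id] at h
    rw [← h, ← det_transpose, det_apply']
    rfl
  rw [Finset.sum_comm, ← det_transpose X, det_apply', Finset.sum_mul]
  refine Finset.sum_congr rfl fun π _ ↦ ?_
  rw [Int.cast_id, mul_right_comm, ← hY, Finset.sum_mul]
  refine Finset.sum_congr rfl fun σ _ ↦ ?_
  rw [Finset.prod_mul_distrib, mul_assoc, mul_comm (∏ i, X i (π i))]
  rfl

/-- The determinant of the complement `J - X` of `X`, when two columns of `X` add up to the
all-ones vector. -/
lemma det_one_sub_of_add_eq_one (X : Matrix ι ι ℤ) {k l : ι}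
    (h : ∀ i, X i k + X i l = 1) :
    (of fun i j ↦ 1 - X i j).det = (-1) ^ (Fintype.card ι - 1) * X.det := by
  let p : ι → ℤ := Pi.single k 1 + Pi.single l 1
  have hX : (of fun i j ↦ 1 - X i j) =
      X * -(1 - replicateCol Unit p * replicateRow Unit (fun _ ↦ (1 : ℤ))) := by
    have hp : X * replicateCol Unit p = replicateCol Unit (fun _ ↦ (1 : ℤ)) := by
      ext i j
      simpa [mul_apply, p, mul_add, Finset.sum_add_distrib, Pi.single_apply] using h i
    rw [neg_sub, mul_sub, mul_one, ← Matrix.mul_assoc, hp]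
    ext i j
    simp [mul_apply]
  have hpos : 0 < Fintype.card ι := Fintype.card_pos_iff.2 ⟨k⟩
  obtain ⟨n, hn⟩ := Nat.exists_eq_succ_of_ne_zero hpos.ne'
  rw [hX, det_mul, det_neg, det_one_sub_mul_comm, hn]
  have : (1 - replicateRow Unit (fun _ : ι ↦ (1 : ℤ)) * replicateCol Unit p).det = -1 := by
    simp [det_unique, mul_apply, p, Finset.sum_add_distrib, Pi.single_apply]
  rw [this, Nat.succ_sub_one, pow_succ]
  ring

lemma isUnit_of_single_mem_range (X : Matrix ι ι ℤ)
    (h : ∀ i, Pi.single i 1 ∈ LinearMap.range X.mulVecLin) : IsUnit X := by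
  rw [← mulVec_surjective_iff_isUnit]
  intro w
  have : w ∈ LinearMap.range X.mulVecLin := by
    rw [← Finset.univ_sum_single w]
    refine Submodule.sum_mem _ fun i _ ↦ ?_
    have := Submodule.smul_mem _ (w i) (h i)
    rwa [← Pi.single_smul, smul_eq_mul, mul_one] at this
  exact this

end Matrix

section Arrowflow

variable {V : Type*} {G : SimpleGraph V} {S : Finset V} {A : Multiset (V × V)}

lemma mem_or_mem_of_not_missingForest_adj {u v : V} (h : G.Adj u v)
    (hn : ¬(missingForest G A).Adj u v) : (u, v) ∈ A ∨ (v, u) ∈ A := by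
  by_contra hc
  refine hn ?_
  simp only [missingForest, arrowSG, SimpleGraph.sdiff_adj, SimpleGraph.fromRel_adj]
  exact ⟨h, fun hh ↦ hc hh.2⟩

lemma not_missingForest_adj_of_mem {u v : V} (h : G.Adj u v) (hA : (u, v) ∈ A) :
    ¬(missingForest G A).Adj u v := by
  simp only [missingForest, arrowSG, SimpleGraph.sdiff_adj, SimpleGraph.fromRel_adj]
  exact fun hh ↦ hh.2 ⟨h.ne, Or.inl hA⟩

/-- A duplicate-free arrowflow with at least as many arrows as the `S`-rooted missing forest
has components contains a pair of opposite arrows. -/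
lemma exists_swap_mem_of_isSRootedForest (hG : G.IsTree) (s₀ : V)
    (hA : IsArrowflow G S.card A) (hnd : A.Nodup)
    (hF : IsSRootedForest G (missingForest G A) S) :
    ∃ p ∈ A, p.swap ∈ A := by
  obtain ⟨hle, -, -, hcov⟩ := hF
  choose r hrS hr using hcov
  have hlt (p : V × V) (hp : p ∈ A) :
      ∃ w x, (p = (w, x) ∨ p = (x, w)) ∧ G.Adj w x ∧ ¬(missingForest G A).Adj w x ∧
        G.dist s₀ x < G.dist s₀ w := by
    obtain ⟨u, v⟩ := p
    have hadj : G.Adj u v := hA.2 _ hp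
    have hn := not_missingForest_adj_of_mem hadj hp
    rcases (hG.dist_ne_of_adj s₀ hadj).lt_or_gt with h | h
    · exact ⟨v, u, Or.inr rfl, hadj.symm, fun hh ↦ hn hh.symm, h⟩
    · exact ⟨u, v, Or.inl rfl, hadj, hn, h⟩
  have : Nonempty V := ⟨s₀⟩
  choose! w x hwx hadj hn hd using hlt
  have hmaps : ∀ p ∈ A.toFinset, r (w p) ∈ S.erase (r s₀) := by
    intro p hp
    rw [Multiset.mem_toFinset] at hp
    refine Finset.mem_erase.2 ⟨fun he ↦ ?_, hrS _⟩
    have hreach : (missingForest G A).Reachable (w p) s₀ := (he ▸ (hr (w p)).symm).trans (hr s₀)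
    exact (hG.lt_of_reachable hle (hadj p hp) (hn p hp) hreach).not_gt (hd p hp)
  have hcard : (S.erase (r s₀)).card < A.toFinset.card := by
    rw [Multiset.toFinset_card_of_nodup hnd, hA.1]
    exact Finset.card_erase_lt_of_mem (hrS s₀)
  obtain ⟨p, hp, q, hq, hpq, he⟩ := Finset.exists_ne_map_eq_of_card_lt_of_maps_to hcard hmaps
  rw [Multiset.mem_toFinset] at hp hq
  obtain ⟨h1, h2⟩ := hG.eq_and_eq_of_reachable_of_lt hle (hadj p hp) (hn p hp) (hadj q hq)
    (hn q hq) ((hr (w p)).symm.trans (he ▸ hr (w q))) (hd p hp) (hd q hq)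
  refine ⟨p, hp, ?_⟩
  have hqp : q = p.swap := by
    rcases hwx p hp with h3 | h3 <;> rcases hwx q hq with h4 | h4 <;>
      rw [← h1, ← h2] at h4
    · exact absurd (h3.trans h4.symm) hpq
    · exact h4.trans (congrArg Prod.swap h3).symm
    · exact h4.trans (congrArg Prod.swap h3).symm
    · exact absurd (h3.trans h4.symm) hpq
  exact hqp ▸ hq

/-- The matrix recording which vertices of `S` lie on the tail side of which arrow. -/
noncomputable def tailMatrix (G : SimpleGraph V) (S : Finset V)
    (a : {x // x ∈ S} → V × V) : Matrix {x // x ∈ S} {x // x ∈ S} ℤ :=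
  Matrix.of fun i k ↦ if G.dist i.1 (a k).1 < G.dist i.1 (a k).2 then 1 else 0

lemma tailMatrix_add_eq_one (hG : G.IsTree) {a : {x // x ∈ S} → V × V} {k l : {x // x ∈ S}}
    (hk : G.Adj (a k).1 (a k).2) (hl : a l = (a k).swap) (i : {x // x ∈ S}) :
    tailMatrix G S a i k + tailMatrix G S a i l = 1 := by
  have := hG.dist_ne_of_adj i.1 hk
  simp only [tailMatrix, Matrix.of_apply, hl, Prod.fst_swap, Prod.snd_swap]
  split_ifs <;> omega

lemma isUnit_tailMatrix [Fintype V] (hG : G.IsTree)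
    (hF : IsSRootedForest G (missingForest G A) S) {a : {x // x ∈ S} → V × V}
    (ha : ∀ p, p ∈ A ↔ ∃ k, a k = p) {k l : {x // x ∈ S}}
    (hk : G.Adj (a k).1 (a k).2) (hl : a l = (a k).swap) :
    IsUnit (tailMatrix G S a) := by
  obtain ⟨hle, -, hsep, -⟩ := hF
  have hcol (j : {x // x ∈ S}) : (fun i ↦ tailMatrix G S a i j) ∈
      LinearMap.range (tailMatrix G S a).mulVecLin :=
    ⟨Pi.single j 1, by rw [Matrix.mulVecLin_apply, Matrix.mulVec_single_one]; rfl⟩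
  have hone : (fun _ ↦ 1) ∈ LinearMap.range (tailMatrix G S a).mulVecLin := by
    convert Submodule.add_mem _ (hcol k) (hcol l) using 1
    exact funext fun i ↦ (tailMatrix_add_eq_one hG hk hl i).symm
  refine Matrix.isUnit_of_single_mem_range _ fun s ↦ ?_
  have hs : Pi.single s 1 = (fun _ ↦ (1 : ℤ)) -
      ∑ p : V × V with (missingForest G A).Reachable s p.1 ∧
        ¬(missingForest G A).Reachable s p.2 ∧ G.Adj p.1 p.2,
        fun t : {x // x ∈ S} ↦ (if G.dist t.1 p.2 < G.dist t.1 p.1 then 1 else 0 : ℤ) := by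
    ext t
    rw [Pi.sub_apply, Finset.sum_apply, hG.sum_leaving_eq hle, Pi.single_apply]
    by_cases hst : t = s
    · subst hst
      simp
    · rw [if_neg hst, if_neg, sub_self]
      exact fun h ↦ hst (Subtype.ext (hsep _ s.2 _ t.2 h).symm)
  rw [hs]
  refine Submodule.sub_mem _ hone (Submodule.sum_mem _ fun p hp ↦ ?_)
  obtain ⟨-, h1, h2, h3⟩ := Finset.mem_filter.1 hp
  rcases mem_or_mem_of_not_missingForest_adj h3
    (fun h : (missingForest G A).Adj p.1 p.2 ↦ h2 (h1.trans h.reachable)) with h | h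
  · obtain ⟨j, hj⟩ := (ha _).1 h
    convert Submodule.sub_mem _ hone (hcol j) using 1
    ext t
    have := hG.dist_ne_of_adj t.1 h3
    simp only [tailMatrix, Matrix.of_apply, hj, Pi.sub_apply]
    split_ifs <;> omega
  · obtain ⟨j, hj⟩ := (ha _).1 h
    convert hcol j using 1
    ext t
    simp only [tailMatrix, Matrix.of_apply, hj]

lemma exists_enumeration_of_nodup (hnd : A.Nodup) (hc : A.card = S.card) :
    ∃ a : {x // x ∈ S} → V × V, Function.Injective a ∧ Induces S a A := by
  have hcard : Fintype.card {x // x ∈ S} = Fintype.card {p // p ∈ A.toFinset} := by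
    rw [Fintype.card_coe, Fintype.card_coe, Multiset.toFinset_card_of_nodup hnd, hc]
  let e := Fintype.equivOfCardEq hcard
  have hinj : Function.Injective fun k ↦ (e k : V × V) :=
    Subtype.val_injective.comp e.injective
  refine ⟨fun k ↦ e k, hinj, ?_⟩
  refine (Multiset.Nodup.ext (Finset.univ.nodup.map hinj) hnd).2 fun p ↦ ?_
  simp only [Multiset.mem_map, Finset.mem_val, Finset.mem_univ, true_and]
  constructor
  · rintro ⟨k, rfl⟩
    exact Multiset.mem_toFinset.1 (e k).2
  · exact fun hp ↦ ⟨e.symm ⟨p, Multiset.mem_toFinset.2 hp⟩, by simp⟩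

lemma Induces.mem_iff {f : {x // x ∈ S} → V × V} (h : Induces S f A) (p : V × V) :
    p ∈ A ↔ ∃ k, f k = p := by
  rw [← h]
  simp only [Multiset.mem_map, Finset.mem_val, Finset.mem_univ, true_and]

lemma Induces.comp_perm {f : {x // x ∈ S} → V × V} (h : Induces S f A)
    (π : Equiv.Perm {x // x ∈ S}) : Induces S (f ∘ π) A := by
  have hπ : Multiset.map π Finset.univ.val = Finset.univ.val := by
    simpa using congrArg Finset.val (Finset.map_univ_equiv π)
  rw [Induces, ← Multiset.map_map, hπ]
  exact h

lemma Induces.exists_perm {f g : {x // x ∈ S} → V × V} (hnd : A.Nodup)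
    (hf : Induces S f A) (hg : Induces S g A) :
    ∃ π : Equiv.Perm {x // x ∈ S}, f ∘ π = g := by
  have hgi : Function.Injective g := fun i j hij ↦
    Multiset.inj_on_of_nodup_map (hg.symm ▸ hnd) i (Finset.mem_univ i) j (Finset.mem_univ j) hij
  have hex (i : {x // x ∈ S}) : ∃ k, f k = g i := (hf.mem_iff _).1 ((hg.mem_iff _).2 ⟨i, rfl⟩)
  choose π hπ using hex
  have hπi : Function.Injective π := fun i j hij ↦ hgi (by rw [← hπ, ← hπ, hij])
  exact ⟨Equiv.ofBijective π (Finite.injective_iff_bijective.1 hπi), funext hπ⟩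

lemma classSum_eq_det_mul_det [Fintype V] (hG : G.IsTree) (hnd : A.Nodup)
    (hadj : ∀ p ∈ A, G.Adj p.1 p.2) {a : {x // x ∈ S} → V × V}
    (hinj : Function.Injective a) (ha : Induces S a A) :
    classSum G S A = (tailMatrix G S a).det *
      (Matrix.of fun i k ↦ 1 - tailMatrix G S a i k).det := by
  rw [← Matrix.det_transpose (Matrix.of _), ← Matrix.sum_perm_sign_mul_prod_eq_det_mul_det,
    classSum, Finset.sum_filter, Fintype.sum_prod_type]
  refine Finset.sum_congr rfl fun σ _ ↦ Eq.symm ?_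
  refine Finset.sum_of_injOn (fun π : Equiv.Perm {x // x ∈ S} ↦ a ∘ π) ?_ (by simp) ?_ ?_
  · intro π _ ρ _ h
    exact Equiv.ext fun i ↦ hinj (congrFun h i)
  · intro f _ hf
    refine if_neg fun h ↦ hf ?_
    obtain ⟨π, hπ⟩ := ha.exists_perm hnd h.2
    exact ⟨π, by simp, hπ⟩
  · intro π _
    have hi (i : {x // x ∈ S}) : tailMatrix G S a i (π i) *
        (Matrix.of fun i k ↦ 1 - tailMatrix G S a i k).transpose (π i) (σ i) =
        if G.Adj (a (π i)).1 (a (π i)).2 ∧ G.dist i.1 (a (π i)).1 + 1 +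
          G.dist (a (π i)).2 (σ i).1 = G.dist i.1 (σ i).1 then 1 else 0 := by
      have h1 : G.Adj (a (π i)).1 (a (π i)).2 := hadj _ ((ha.mem_iff _).2 ⟨_, rfl⟩)
      have h2 := hG.dist_ne_of_adj (σ i).1 h1
      simp only [tailMatrix, Matrix.transpose_apply, Matrix.of_apply, h1, true_and,
        hG.dist_add_one_add_dist_eq_iff_s7 h1]
      grind
    simp only [hi, Finset.prod_ite_zero, Finset.prod_const_one, mul_ite, mul_one, mul_zero]
    refine if_congr ?_ rfl rfl
    simp [IsCatalyst, ha.comp_perm π]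

end Arrowflow

theorem unital_arrowflow_class_sum
    {V : Type*} [Fintype V] (G : SimpleGraph V) (hG : G.IsTree)
    (S : Finset V) (m : ℕ) (hm : S.card = m) (hm2 : 2 ≤ m)
    (A : Multiset (V × V)) (hA : IsArrowflow G m A) (hu : IsUnital G S A) :
    classSum G S A = (-1) ^ (m - 1) := by
  subst hm
  obtain ⟨hpar, hF⟩ := hu
  have hnd : A.Nodup := by
    rw [Multiset.nodup_iff_count_le_one]
    intro p
    by_contra h
    exact hpar ⟨p, by omega⟩
  obtain ⟨s₀, -⟩ : S.Nonempty := Finset.card_pos.1 (by omega)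
  obtain ⟨a, hinj, ha⟩ := exists_enumeration_of_nodup hnd hA.1
  obtain ⟨p, hp, hp'⟩ := exists_swap_mem_of_isSRootedForest hG s₀ hA hnd hF
  obtain ⟨k, rfl⟩ := (ha.mem_iff _).1 hp
  obtain ⟨l, hl⟩ := (ha.mem_iff _).1 hp'
  have hk := hA.2 _ hp
  have hdet := (Matrix.isUnit_iff_isUnit_det _).1 (isUnit_tailMatrix hG hF ha.mem_iff hk hl)
  rw [classSum_eq_det_mul_det hG hnd hA.2 hinj ha,
    Matrix.det_one_sub_of_add_eq_one _ (tailMatrix_add_eq_one hG hk hl), Fintype.card_coe,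
    mul_left_comm, Int.isUnit_mul_self hdet, mul_one]
end

section
/- Let T be a finite tree, let S be a subset of its vertices of cardinality m ≥ 2, and let F be an S-rooted spanning forest of T. Then the number of m-arrowflows A on T that are unital for S and have missing forest M(A) = F is exactly (m-1) · 2^{m-2}. -/
open scoped Classical

open Finset

/-- Joining the trees rooted at `s` and `t` by the edge `st` leaves `S \ {t}` as a set of roots. -/
theorem IsSRootedForest.sup_edge {V : Type*} {F : SimpleGraph V} {S : Finset V}
    (hF : IsSRootedForest ⊤ F S) {s t : V} (hs : s ∈ S) (ht : t ∈ S) (hst : s ≠ t) :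
    IsSRootedForest ⊤ (F ⊔ SimpleGraph.edge s t) (S.erase t) := by
  obtain ⟨-, hacyc, huniq, hcov⟩ := hF
  have hnr : ¬ F.Reachable s t := fun h => hst (huniq s hs t ht h)
  refine ⟨le_top, hacyc.sup_edge_of_not_reachable hnr, ?_, ?_⟩
  · choose r hrS hr using hcov
    have hroot : ∀ a ∈ S, r a = a := fun a ha => huniq _ (hrS a) a ha (hr a)
    let c : V → V := fun v => if r v = t then s else r v
    have hc : ∀ u v, (F ⊔ SimpleGraph.edge s t).Reachable u v → c u = c v := by
      rintro u v ⟨p⟩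
      induction p with
      | nil => rfl
      | @cons u v w h p ih =>
        rw [← ih]
        rw [SimpleGraph.sup_adj, SimpleGraph.edge_adj] at h
        rcases h with h | ⟨⟨rfl, rfl⟩ | ⟨rfl, rfl⟩, -⟩
        · have : r u = r v :=
            huniq _ (hrS u) _ (hrS v) (((hr u).trans h.reachable).trans (hr v).symm)
          simp [c, this]
        · simp [c, hroot _ hs, hroot _ ht]
        · simp [c, hroot _ hs, hroot _ ht]
    intro a ha b hb hab
    rw [mem_erase] at ha hb
    have := hc a b hab
    simpa [c, hroot a ha.2, hroot b hb.2, ha.1, hb.1] using this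
  · intro v
    obtain ⟨a, ha, hav⟩ := hcov v
    have hle : F ≤ F ⊔ SimpleGraph.edge s t := le_sup_left
    by_cases hat : a = t
    · subst hat
      have hadj : (F ⊔ SimpleGraph.edge s a).Adj s a := by
        simp [SimpleGraph.edge_adj, hst]
      exact ⟨s, mem_erase.2 ⟨hst, hs⟩, hadj.reachable.trans (hav.mono hle)⟩
    · exact ⟨a, mem_erase.2 ⟨hat, ha⟩, hav.mono hle⟩

/-- A spanning forest rooted at `S` has `|V| - |S|` edges. -/
theorem IsSRootedForest.card_edgeFinset_add_card {V : Type*} [Fintype V] {G F : SimpleGraph V}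
    {S : Finset V} (hF : IsSRootedForest G F S) (hS : S.Nonempty) :
    #F.edgeFinset + #S = Fintype.card V := by
  replace hF : IsSRootedForest ⊤ F S := ⟨le_top, hF.2⟩
  clear G
  induction hn : #S generalizing S F with
  | zero => simp_all
  | succ n ih =>
    rcases Nat.eq_zero_or_pos n with rfl | hpos
    · obtain ⟨s, rfl⟩ := card_eq_one.1 hn
      have hreach : ∀ v, F.Reachable s v := by simpa using hF.2.2.2
      have : Nonempty V := ⟨s⟩
      exact SimpleGraph.IsTree.card_edgeFinset
        ⟨⟨fun u v => (hreach u).symm.trans (hreach v)⟩, hF.2.1⟩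
    · obtain ⟨s, hs, t, ht, hst⟩ := one_lt_card.1 (show 1 < #S by lia)
      have hnadj : ¬ F.Adj s t := fun h => hst (hF.2.2.1 s hs t ht h.reachable)
      have hcard : #(S.erase t) = n := by rw [card_erase_of_mem ht]; lia
      have := ih (card_pos.1 (by lia)) (hF.sup_edge hs ht hst) hcard
      rw [← this, ← add_assoc, add_right_comm]
      congr 1
      symm
      convert F.card_edgeFinset_sup_edge hnadj hst

/-- The number of sets of ordered pairs covering a set `E` of edges with exactly one more pair
than there are edges: one edge is covered twice, and the others are oriented freely. -/
theorem card_filter_image_mk_eq {V : Type*} [Fintype V] (E : Finset (Sym2 V))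
    (hE : ∀ e ∈ E, ¬ e.IsDiag) :
    #{B : Finset (V × V) | B.image (fun p => s(p.1, p.2)) = E ∧ #B = #E + 1} =
      #E * 2 ^ (#E - 1) := by
  obtain ⟨o, ho⟩ : ∃ o : Sym2 V → V × V, ∀ e, s((o e).1, (o e).2) = e :=
    ⟨fun e => (e.out.1, e.out.2), fun e => Quot.out_eq e⟩
  have hos : ∀ e, s((o e).2, (o e).1) = e := fun e => Sym2.eq_swap.trans (ho e)
  have hinj : Function.Injective o := fun a b h => by rw [← ho a, h, ho b]
  have hsinj : Function.Injective fun e => (o e).swap := Prod.swap_injective.comp hinj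
  have hne : ∀ e ∈ E, ∀ e', o e ≠ (o e').swap := by
    intro e he e' h
    have hee : e = e' := by rw [← ho e, h]; exact hos e'
    subst hee
    refine hE e he ?_
    rw [← ho e, Sym2.mk_isDiag_iff]
    exact congrArg Prod.fst h
  have hpair : ∀ p : V × V, p = o s(p.1, p.2) ∨ p = (o s(p.1, p.2)).swap := fun p =>
    Sym2.mk_eq_mk_iff.1 (ho s(p.1, p.2)).symm
  let f : Finset (Sym2 V) → Finset (Sym2 V) → Finset (V × V) := fun P N =>
    P.image o ∪ N.image fun e => (o e).swap
  have hmem_o : ∀ {P N : Finset (Sym2 V)}, N ⊆ E → ∀ {e}, o e ∈ f P N ↔ e ∈ P := by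
    intro P N hN e
    simp only [f, mem_union, mem_image]
    constructor
    · rintro (⟨a, ha, h⟩ | ⟨a, ha, h⟩)
      · exact hinj h ▸ ha
      · have hae : a = e := by rw [← ho e, ← h]; exact (hos a).symm
        subst hae
        exact absurd h.symm (hne a (hN ha) a)
    · exact fun h => Or.inl ⟨e, h, rfl⟩
  have hmem_s : ∀ {P N : Finset (Sym2 V)}, P ⊆ E → ∀ {e}, (o e).swap ∈ f P N ↔ e ∈ N := by
    intro P N hP e
    simp only [f, mem_union, mem_image]
    constructor
    · rintro (⟨a, ha, h⟩ | ⟨a, ha, h⟩)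
      · exact absurd h (hne a (hP ha) e)
      · exact hsinj h ▸ ha
    · exact fun h => Or.inr ⟨e, h, rfl⟩
  have hcard : ∀ P N : Finset (Sym2 V), P ⊆ E → #(f P N) = #P + #N := by
    intro P N hP
    rw [card_union_of_disjoint, card_image_of_injective _ hinj, card_image_of_injective _ hsinj]
    rw [disjoint_left]
    intro p hp hp'
    obtain ⟨a, ha, rfl⟩ := mem_image.1 hp
    obtain ⟨b, hb, h⟩ := mem_image.1 hp'
    exact hne a (hP ha) b h.symm
  have himage : ∀ P N : Finset (Sym2 V), (f P N).image (fun p => s(p.1, p.2)) = P ∪ N := by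
    intro P N
    simp [f, image_union, image_image, Function.comp_def, ho, hos]
  have hcount : #(E.sigma fun e => (E.erase e).powerset) = #E * 2 ^ (#E - 1) := by
    rw [card_sigma, sum_congr rfl fun e he => by rw [card_powerset, card_erase_of_mem he],
      sum_const, smul_eq_mul]
  rw [← hcount]
  symm
  refine card_bij (fun x _ => f (insert x.1 x.2) (E \ x.2)) ?_ ?_ ?_
  · rintro ⟨e, X⟩ h
    simp only [mem_sigma, mem_powerset] at h
    obtain ⟨he, hX⟩ := h
    have hXE : X ⊆ E := hX.trans (erase_subset _ _)
    have heX : e ∉ X := fun h => by simpa using hX h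
    have hP : insert e X ⊆ E := insert_subset he hXE
    simp only [mem_filter, mem_univ, true_and, himage, hcard _ _ hP, card_insert_of_notMem heX]
    refine ⟨?_, ?_⟩
    · ext x; simp only [mem_union, mem_insert, mem_sdiff]; grind
    · have := card_sdiff_add_card_eq_card hXE
      lia
  · rintro ⟨e, X⟩ h ⟨e', X'⟩ h' heq
    simp only [mem_sigma, mem_powerset] at h h'
    obtain ⟨he, hX⟩ := h
    obtain ⟨he', hX'⟩ := h'
    have hP : insert e X ⊆ E := insert_subset he (hX.trans (erase_subset _ _))
    have hP' : insert e' X' ⊆ E := insert_subset he' (hX'.trans (erase_subset _ _))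
    have h1 : insert e X = insert e' X' := by
      ext a
      rw [← hmem_o (sdiff_subset (s := E) (t := X)), heq, hmem_o sdiff_subset]
    have h2 : E \ X = E \ X' := by
      ext a
      rw [← hmem_s hP, heq, hmem_s hP']
    have hXX : X = X' := by
      rw [← Finset.sdiff_sdiff_eq_self (hX.trans (erase_subset _ _)), h2,
        Finset.sdiff_sdiff_eq_self (hX'.trans (erase_subset _ _))]
    subst hXX
    have heX : e ∉ X := fun h => by simpa using hX h
    have hee : e = e' := by
      have : e ∈ insert e' X := h1 ▸ mem_insert_self e X
      exact (mem_insert.1 this).resolve_right heX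
    rw [hee]
  · intro B hB
    simp only [mem_filter, mem_univ, true_and] at hB
    obtain ⟨hBE, hBcard⟩ := hB
    have hBmem : ∀ p ∈ B, s(p.1, p.2) ∈ E := fun p hp => hBE ▸ mem_image_of_mem _ hp
    let P := E.filter fun e => o e ∈ B
    let N := E.filter fun e => (o e).swap ∈ B
    have hPE : P ⊆ E := filter_subset _ _
    have hf : f P N = B := by
      ext p
      simp only [f, P, N, mem_union, mem_image, mem_filter]
      constructor
      · rintro (⟨a, ⟨-, h⟩, rfl⟩ | ⟨a, ⟨-, h⟩, rfl⟩) <;> exact h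
      · intro hp
        rcases hpair p with h | h
        · exact Or.inl ⟨_, ⟨hBmem p hp, h ▸ hp⟩, h.symm⟩
        · exact Or.inr ⟨_, ⟨hBmem p hp, h ▸ hp⟩, h.symm⟩
    have hunion : P ∪ N = E := by rw [← himage, hf, hBE]
    have hinter : #(P ∩ N) = 1 := by
      have h1 := card_union_add_card_inter P N
      have h2 := hcard P N hPE
      rw [hf] at h2
      rw [hunion] at h1
      lia
    obtain ⟨e, he⟩ := card_eq_one.1 hinter
    have hePN : e ∈ P ∧ e ∈ N := mem_inter.1 (he ▸ mem_singleton_self e)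
    have honly : ∀ x, x ∈ P → x ∈ N → x = e := fun x hx hx' =>
      mem_singleton.1 (he ▸ mem_inter.2 ⟨hx, hx'⟩)
    refine ⟨⟨e, P.erase e⟩, ?_, ?_⟩
    · simp only [mem_sigma, mem_powerset]
      exact ⟨hPE hePN.1, erase_subset_erase e hPE⟩
    · have hN : E \ P.erase e = N := by
        rw [← hunion]
        ext x
        simp only [mem_sdiff, mem_union, mem_erase]
        grind
      simp only [insert_erase hePN.1, hN, hf]

/-- A set of arcs is supported on `G` with missing forest `F` iff it covers exactly the edges of `G`
outside `F`. -/
theorem missingForest_eq_iff {V : Type*} [Fintype V] {G F : SimpleGraph V} (hFG : F ≤ G)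
    {B : Finset (V × V)} :
    ((∀ p ∈ B, G.Adj p.1 p.2) ∧ missingForest G B.val = F) ↔
      B.image (fun p => s(p.1, p.2)) = G.edgeFinset \ F.edgeFinset := by
  have hSG : ∀ u v, G.Adj u v →
      ((arrowSG B.val).Adj u v ↔ s(u, v) ∈ B.image fun p => s(p.1, p.2)) := by
    intro u v huv
    simp only [arrowSG, SimpleGraph.fromRel_adj, mem_val, mem_image, Prod.exists, Sym2.eq_iff]
    have := huv.ne
    grind
  constructor
  · rintro ⟨hB, rfl⟩
    ext e
    induction e with | h u v =>
    rw [mem_sdiff, SimpleGraph.mem_edgeFinset, SimpleGraph.mem_edgeFinset,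
      SimpleGraph.mem_edgeSet, SimpleGraph.mem_edgeSet, missingForest, SimpleGraph.sdiff_adj]
    constructor
    · intro h
      have huv : G.Adj u v := by
        obtain ⟨p, hp, hpe⟩ := mem_image.1 h
        rw [← SimpleGraph.mem_edgeSet, ← hpe]
        exact hB p hp
      exact ⟨huv, fun h' => h'.2 ((hSG u v huv).2 h)⟩
    · rintro ⟨huv, h⟩
      rw [← hSG u v huv]
      tauto
  · intro h
    have hmem : ∀ u v, s(u, v) ∈ B.image (fun p => s(p.1, p.2)) ↔ G.Adj u v ∧ ¬ F.Adj u v := by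
      intro u v
      simp [h]
    refine ⟨fun p hp => ((hmem p.1 p.2).1 (mem_image_of_mem _ hp)).1, ?_⟩
    ext u v
    rw [missingForest, SimpleGraph.sdiff_adj]
    constructor
    · rintro ⟨huv, h'⟩
      rw [hSG u v huv, hmem] at h'
      tauto
    · intro huv
      refine ⟨hFG huv, ?_⟩
      rw [hSG u v (hFG huv), hmem]
      tauto

theorem count_unital_arrowflows_with_missing_forest
    {V : Type*} [Fintype V] (G : SimpleGraph V) (hG : G.IsTree)
    (S : Finset V) (m : ℕ) (hm : S.card = m) (hm2 : 2 ≤ m)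
    (F : SimpleGraph V) (hF : IsSRootedForest G F S) :
    Set.ncard {A : Multiset (V × V) |
        IsArrowflow G m A ∧ IsUnital G S A ∧ missingForest G A = F} =
      (m - 1) * 2 ^ (m - 2) := by
  have hedges : #(G.edgeFinset \ F.edgeFinset) + 1 = m := by
    have h1 := hG.card_edgeFinset
    have h2 := hF.card_edgeFinset_add_card (card_pos.1 (by lia))
    have h3 := card_sdiff_add_card_eq_card (SimpleGraph.edgeFinset_mono hF.1)
    lia
  have hset : {A : Multiset (V × V) |
      IsArrowflow G m A ∧ IsUnital G S A ∧ missingForest G A = F} =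
      Set.image Finset.val (({B : Finset (V × V) |
        B.image (fun p => s(p.1, p.2)) = G.edgeFinset \ F.edgeFinset ∧
          #B = #(G.edgeFinset \ F.edgeFinset) + 1} : Finset (Finset (V × V))) :
            Set (Finset (V × V))) := by
    ext A
    simp only [Set.mem_ofPred_eq, Set.mem_image, mem_coe, mem_filter, mem_univ, true_and]
    constructor
    · rintro ⟨⟨hcard, hadj⟩, ⟨hpar, -⟩, hM⟩
      have hnodup : A.Nodup := Multiset.nodup_iff_count_le_one.2 fun p => by
        by_contra h
        exact hpar ⟨p, by lia⟩
      exact ⟨⟨A, hnodup⟩, ⟨(missingForest_eq_iff hF.1).1 ⟨hadj, hM⟩, by rw [hedges]; exact hcard⟩,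
        rfl⟩
    · rintro ⟨B, ⟨hB, hcard⟩, rfl⟩
      obtain ⟨hadj, hM⟩ := (missingForest_eq_iff hF.1).2 hB
      refine ⟨⟨hcard.trans hedges, hadj⟩, ⟨?_, by rwa [hM]⟩, hM⟩
      rintro ⟨p, hp⟩
      have := Multiset.nodup_iff_count_le_one.1 B.nodup p
      lia
  rw [hset, Set.ncard_image_of_injective _ Finset.val_injective, Set.ncard_coe_finset,
    card_filter_image_mk_eq _ fun e he =>
      G.not_isDiag_of_mem_edgeFinset (mem_sdiff.1 he).1]
  congr 2 <;> lia
end
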